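/- arXiv:2509.03258 — 7 statements merged into one kernel-verified Lean document; each statement's English description precedes it below -/
import Mathlib

section
/- Let Z, Z̃ be finite-dimensional real Hilbert spaces, let Ψ : Z → (−∞,∞] be proper lower semicontinuous convex and coercive (Ψ(z) → ∞ as ‖z‖ → ∞), and let B : Z → Z̃ be a linear operator. Then for every z ∈ Z the following identity holds in the extended reals: Ψ_B(z) = Ψ(z) − (1/2)‖Bz‖² + (Ψ + (1/2)‖B·‖²)*(B*Bz), where Ψ_B(z) := Ψ(z) − inf_{v∈Z}[Ψ(v) + (1/2)‖B(z−v)‖²]. -/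
open scoped Pointwise RealInnerProductSpace

noncomputable section

/-- Convexity for extended-real-valued functions. -/
def EConvex {H : Type*} [AddCommGroup H] [Module ℝ H] (φ : H → EReal) : Prop :=
  ∀ (x y : H) (a b : ℝ), 0 ≤ a → 0 ≤ b → a + b = 1 →
    φ (a • x + b • y) ≤ (a : EReal) * φ x + (b : EReal) * φ y

/-- Coercivity (`φ u → ∞` as `‖u‖ → ∞`) for extended-real-valued functions. -/
def ECoercive {H : Type*} [NormedAddCommGroup H] (φ : H → EReal) : Prop :=
  ∀ C : ℝ, ∃ R : ℝ, ∀ x : H, R ≤ ‖x‖ → (C : EReal) ≤ φ x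

/-- Legendre–Fenchel conjugate `φ*(y) = sup_v (⟨v, y⟩ − φ(v))`. -/
noncomputable def fenchel {H : Type*} [NormedAddCommGroup H] [InnerProductSpace ℝ H]
    (φ : H → EReal) (y : H) : EReal :=
  ⨆ v : H, ((⟪v, y⟫ : ℝ) : EReal) - φ v

/-- Generalized Moreau enhanced function `Ψ_B(z) = Ψ(z) − inf_v [Ψ(v) + (1/2)‖B(z−v)‖²]`. -/
noncomputable def GME {Z Z' : Type*} [NormedAddCommGroup Z] [InnerProductSpace ℝ Z]
    [NormedAddCommGroup Z'] [InnerProductSpace ℝ Z']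
    (Ψ : Z → EReal) (B : Z →ₗ[ℝ] Z') (z : Z) : EReal :=
  Ψ z - ⨅ v : Z, (Ψ v + ((((1 : ℝ) / 2) * ‖B (z - v)‖ ^ 2 : ℝ) : EReal))

theorem EReal.coe_add_iSup {ι : Sort*} (c : ℝ) (g : ι → EReal) :
    (c : EReal) + ⨆ i, g i = ⨆ i, (c : EReal) + g i := by
  refine le_antisymm ?_ (iSup_le fun i => add_le_add_right (le_iSup g i) _)
  rw [add_comm, ← EReal.le_sub_iff_add_le (.inl (EReal.coe_ne_bot c)) (.inl (EReal.coe_ne_top c))]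
  refine iSup_le fun i => ?_
  rw [EReal.le_sub_iff_add_le (.inl (EReal.coe_ne_bot c)) (.inl (EReal.coe_ne_top c)), add_comm]
  exact le_iSup (fun i => (c : EReal) + g i) i

theorem EReal.neg_iInf {ι : Sort*} (f : ι → EReal) : -(⨅ i, f i) = ⨆ i, -f i :=
  EReal.negOrderIso.map_iInf f

theorem stmt2 {Z Z' : Type*}
    [NormedAddCommGroup Z] [InnerProductSpace ℝ Z] [FiniteDimensional ℝ Z]
    [NormedAddCommGroup Z'] [InnerProductSpace ℝ Z'] [FiniteDimensional ℝ Z']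
    (Ψ : Z → EReal) (hΨbot : ∀ z, Ψ z ≠ ⊥) (hΨprop : ∃ z, Ψ z ≠ ⊤)
    (hΨlsc : LowerSemicontinuous Ψ) (hΨconv : EConvex Ψ) (hΨcoer : ECoercive Ψ)
    (B : Z →ₗ[ℝ] Z') :
    ∀ z : Z,
      GME Ψ B z
        = Ψ z - ((((1 : ℝ) / 2) * ‖B z‖ ^ 2 : ℝ) : EReal)
          + fenchel (fun v => Ψ v + ((((1 : ℝ) / 2) * ‖B v‖ ^ 2 : ℝ) : EReal))
              ((LinearMap.adjoint B) (B z)) := by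
  intro z
  have key : -(⨅ v : Z, (Ψ v + ((((1 : ℝ) / 2) * ‖B (z - v)‖ ^ 2 : ℝ) : EReal)))
      = ((-(((1 : ℝ) / 2) * ‖B z‖ ^ 2) : ℝ) : EReal)
        + fenchel (fun v => Ψ v + ((((1 : ℝ) / 2) * ‖B v‖ ^ 2 : ℝ) : EReal))
            ((LinearMap.adjoint B) (B z)) := by
    rw [fenchel, EReal.coe_add_iSup, EReal.neg_iInf]
    refine iSup_congr fun v => ?_
    have expand : -((1 : ℝ) / 2 * ‖B (z - v)‖ ^ 2) = -((1 : ℝ) / 2 * ‖B z‖ ^ 2)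
        + (⟪v, (LinearMap.adjoint B) (B z)⟫ + -((1 : ℝ) / 2 * ‖B v‖ ^ 2)) := by
      rw [LinearMap.adjoint_inner_right, map_sub, norm_sub_sq_real, real_inner_comm]
      ring
    rw [EReal.neg_add (.inr (EReal.coe_ne_top _)) (.inr (EReal.coe_ne_bot _)), sub_eq_add_neg,
      ← EReal.coe_neg, expand, sub_eq_add_neg,
      EReal.neg_add (.inr (EReal.coe_ne_top _)) (.inr (EReal.coe_ne_bot _)), sub_eq_add_neg,
      ← EReal.coe_neg, EReal.coe_add, EReal.coe_add]
    ac_rfl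
  rw [GME, sub_eq_add_neg, key, ← add_assoc, EReal.coe_neg, ← sub_eq_add_neg]
end
end

section
/- In the GME model setting, the function Ψ_B∘𝔏 : X → (−∞,∞] is proper and lower semicontinuous with dom(Ψ_B∘𝔏) = dom(Ψ∘𝔏), and (Ψ_B∘𝔏) + q_{𝔏*B*B𝔏} is convex; that is, Ψ_B∘𝔏 is 1-weakly convex relative to q_{𝔏*B*B𝔏}. -/
open scoped Pointwise RealInnerProductSpace

noncomputable section

/-- The quadratic form `q_M(x) = (1/2)⟨Mx, x⟩`. -/
noncomputable def qForm {H : Type*} [NormedAddCommGroup H] [InnerProductSpace ℝ H]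
    (M : H →ₗ[ℝ] H) (x : H) : ℝ := (1 / 2) * ⟪M x, x⟫

/-- Adding a real-valued convex function preserves extended-real convexity. -/
theorem EConvex.add_coe {H : Type*} [AddCommGroup H] [Module ℝ H] {φ : H → EReal} {g : H → ℝ}
    (hφ : EConvex φ) (hg : ConvexOn ℝ Set.univ g) : EConvex (fun x => φ x + (g x : EReal)) := by
  intro x y a b ha hb hab
  have ha' : (0 : EReal) ≤ a := by exact_mod_cast ha
  have hb' : (0 : EReal) ≤ b := by exact_mod_cast hb
  have h : (g (a • x + b • y) : EReal) ≤ (a : EReal) * g x + (b : EReal) * g y := by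
    exact_mod_cast hg.2 (Set.mem_univ x) (Set.mem_univ y) ha hb hab
  calc φ (a • x + b • y) + (g (a • x + b • y) : EReal)
      ≤ ((a : EReal) * φ x + b * φ y) + ((a : EReal) * g x + b * g y) :=
        add_le_add (hφ x y a b ha hb hab) h
    _ = (a : EReal) * (φ x + g x) + b * (φ y + g y) := by
        rw [EReal.left_distrib_of_nonneg_of_ne_top ha' (EReal.coe_ne_top a),
          EReal.left_distrib_of_nonneg_of_ne_top hb' (EReal.coe_ne_top b), add_add_add_comm]

/-- Extended-real convexity is preserved by precomposition with a linear map. -/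
theorem EConvex.comp_linearMap {H K : Type*} [AddCommGroup H] [Module ℝ H] [AddCommGroup K]
    [Module ℝ K] {φ : K → EReal} (hφ : EConvex φ) (L : H →ₗ[ℝ] K) :
    EConvex (fun x => φ (L x)) := by
  intro x y a b ha hb hab
  simpa using hφ (L x) (L y) a b ha hb hab

/-- A coercive lower semicontinuous function that never takes the value `⊥` is bounded below. -/
theorem ECoercive.exists_lower_bound {H : Type*} [NormedAddCommGroup H] [ProperSpace H]
    {φ : H → EReal} (hφ : ECoercive φ) (hlsc : LowerSemicontinuous φ) (hbot : ∀ x, φ x ≠ ⊥) :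
    ∃ m : EReal, m ≠ ⊥ ∧ ∀ x, m ≤ φ x := by
  obtain ⟨R, hR⟩ := hφ 0
  obtain ⟨u, -, hu⟩ := (hlsc.lowerSemicontinuousOn _).exists_isMinOn
    (Metric.nonempty_closedBall.2 (le_max_right R 0))
    (isCompact_closedBall (0 : H) (max R 0))
  refine ⟨min (φ u) 0, ?_, fun x => ?_⟩
  · rcases min_choice (φ u) 0 with h | h <;> rw [h]
    · exact hbot u
    · exact EReal.zero_ne_bot
  · rcases le_total R ‖x‖ with h | h
    · exact (min_le_right _ _).trans (by simpa using hR x h)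
    · exact (min_le_left _ _).trans
        (hu (mem_closedBall_zero_iff.2 (h.trans (le_max_left R 0))))

section MoreauEnvelope

variable {Z Z' : Type*} [NormedAddCommGroup Z] [InnerProductSpace ℝ Z]
  [NormedAddCommGroup Z'] [InnerProductSpace ℝ Z']

/-- The generalized Moreau envelope `z ↦ inf_v [Ψ(v) + (1/2)‖B(z−v)‖²]`. -/
def moreauEnvelope (Ψ : Z → EReal) (B : Z →ₗ[ℝ] Z') (z : Z) : EReal :=
  ⨅ v : Z, (Ψ v + ((((1 : ℝ) / 2) * ‖B (z - v)‖ ^ 2 : ℝ) : EReal))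

theorem moreauEnvelope_ne_top {Ψ : Z → EReal} {u : Z} (hu : Ψ u ≠ ⊤) (B : Z →ₗ[ℝ] Z') (z : Z) :
    moreauEnvelope Ψ B z ≠ ⊤ :=
  ne_top_of_le_ne_top (EReal.add_ne_top hu (EReal.coe_ne_top _)) (iInf_le _ u)

theorem moreauEnvelope_ne_bot {Ψ : Z → EReal} {m : EReal} (hm : m ≠ ⊥) (hΨ : ∀ v, m ≤ Ψ v)
    (B : Z →ₗ[ℝ] Z') (z : Z) : moreauEnvelope Ψ B z ≠ ⊥ := by
  refine ne_bot_of_le_ne_bot hm (le_iInf fun v => (hΨ v).trans ?_)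
  refine le_add_of_nonneg_right ?_
  exact_mod_cast (by positivity : (0 : ℝ) ≤ 1 / 2 * ‖B (z - v)‖ ^ 2)

variable {Ψ : Z → EReal} {B : Z →ₗ[ℝ] Z'} {e : Z → ℝ}

theorem upperSemicontinuous_of_coe_eq_moreauEnvelope [FiniteDimensional ℝ Z]
    (he : ∀ z, (e z : EReal) = moreauEnvelope Ψ B z) (hbot : ∀ z, Ψ z ≠ ⊥) :
    UpperSemicontinuous e := by
  intro z c hc
  have h : moreauEnvelope Ψ B z < c := by rw [← he]; exact_mod_cast hc
  obtain ⟨v, hv⟩ := iInf_lt_iff.1 h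
  have hv_top : Ψ v ≠ ⊤ := by
    intro h
    rw [h, EReal.top_add_coe] at hv
    exact not_top_lt hv
  lift Ψ v to ℝ using ⟨hv_top, hbot v⟩ with r hr
  have hv' : r + 1 / 2 * ‖B (z - v)‖ ^ 2 < c := by exact_mod_cast hv
  have hB : Continuous B := B.continuous_of_finiteDimensional
  have hcont : Continuous fun w => r + 1 / 2 * ‖B (w - v)‖ ^ 2 := by fun_prop
  filter_upwards [hcont.continuousAt.eventually_lt_const hv'] with w hw
  refine lt_of_le_of_lt ?_ hw
  have : (e w : EReal) ≤ (r : EReal) + ((1 / 2 * ‖B (w - v)‖ ^ 2 : ℝ) : EReal) := by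
    rw [he, hr]
    exact iInf_le _ v
  exact_mod_cast this

theorem convexOn_half_sq_norm_sub_of_coe_eq_moreauEnvelope
    (he : ∀ z, (e z : EReal) = moreauEnvelope Ψ B z) (hbot : ∀ z, Ψ z ≠ ⊥) :
    ConvexOn ℝ Set.univ fun z => 1 / 2 * ‖B z‖ ^ 2 - e z := by
  refine ⟨convex_univ, fun x _ y _ a b ha hb hab => ?_⟩
  simp only [smul_eq_mul]
  suffices h : (((1 / 2 * ‖B (a • x + b • y)‖ ^ 2 - (a * (1 / 2 * ‖B x‖ ^ 2 - e x)
      + b * (1 / 2 * ‖B y‖ ^ 2 - e y)) : ℝ)) : EReal) ≤ e (a • x + b • y) by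
    linarith [EReal.coe_le_coe_iff.1 h]
  rw [he]
  refine le_iInf fun v => ?_
  by_cases hv_top : Ψ v = ⊤
  · rw [hv_top, EReal.top_add_coe]
    exact le_top
  have hle (w : Z) : (e w : EReal) ≤ Ψ v + ((1 / 2 * ‖B (w - v)‖ ^ 2 : ℝ) : EReal) := by
    rw [he]
    exact iInf_le _ v
  lift Ψ v to ℝ using ⟨hv_top, hbot v⟩ with r
  have hx : e x ≤ r + 1 / 2 * ‖B (x - v)‖ ^ 2 := by exact_mod_cast hle x
  have hy : e y ≤ r + 1 / 2 * ‖B (y - v)‖ ^ 2 := by exact_mod_cast hle y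
  rw [← EReal.coe_add, EReal.coe_le_coe_iff]
  have hxa := mul_le_mul_of_nonneg_left hx ha
  have hyb := mul_le_mul_of_nonneg_left hy hb
  simp only [map_sub, map_add, map_smul, norm_sub_sq_real, inner_add_left,
    real_inner_smul_left] at hxa hyb ⊢
  obtain rfl : b = 1 - a := by linarith
  linarith

end MoreauEnvelope

theorem stmt4
    {X Y Z Z' W : Type*}
    [NormedAddCommGroup X] [InnerProductSpace ℝ X] [FiniteDimensional ℝ X]
    [NormedAddCommGroup Y] [InnerProductSpace ℝ Y] [FiniteDimensional ℝ Y]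
    [NormedAddCommGroup Z] [InnerProductSpace ℝ Z] [FiniteDimensional ℝ Z]
    [NormedAddCommGroup Z'] [InnerProductSpace ℝ Z'] [FiniteDimensional ℝ Z']
    [NormedAddCommGroup W] [InnerProductSpace ℝ W] [FiniteDimensional ℝ W]
    (A : X →ₗ[ℝ] Y) (Lm : X →ₗ[ℝ] Z) (B : Z →ₗ[ℝ] Z') (Cm : X →ₗ[ℝ] W)
    (f : Y → ℝ) (hf : ConvexOn ℝ Set.univ f)
    (Ψ : Z → EReal) (hΨbot : ∀ z : Z, Ψ z ≠ ⊥) (hΨlsc : LowerSemicontinuous Ψ)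
    (hΨconv : EConvex Ψ) (hΨcoer : ECoercive Ψ)
    (μ : ℝ) (hμ : 0 < μ)
    (Δ : Set W) (hΔne : Δ.Nonempty) (hΔcl : IsClosed Δ) (hΔcv : Convex ℝ Δ)
    (hfeas : ∃ x : X, Ψ (Lm x) ≠ ⊤ ∧ Cm x ∈ Δ)
    :
    (∀ x : X, GME Ψ B (Lm x) ≠ ⊥) ∧
    (∃ x : X, GME Ψ B (Lm x) ≠ ⊤) ∧
    ({x : X | GME Ψ B (Lm x) ≠ ⊤} = {x : X | Ψ (Lm x) ≠ ⊤}) ∧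
    LowerSemicontinuous (fun x : X => GME Ψ B (Lm x)) ∧
    EConvex (fun x : X =>
      GME Ψ B (Lm x)
        + ((qForm (LinearMap.adjoint Lm ∘ₗ LinearMap.adjoint B ∘ₗ B ∘ₗ Lm) x : ℝ) : EReal)) := by
  obtain ⟨x₀, hx₀, -⟩ := hfeas
  obtain ⟨m, hm, hmΨ⟩ := hΨcoer.exists_lower_bound hΨlsc hΨbot
  have hex (z : Z) : ∃ r : ℝ, (r : EReal) = moreauEnvelope Ψ B z :=
    ⟨_, EReal.coe_toReal (moreauEnvelope_ne_top hx₀ B z) (moreauEnvelope_ne_bot hm hmΨ B z)⟩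
  choose e he using hex
  have hGME (z : Z) : GME Ψ B z = Ψ z + ((-e z : ℝ) : EReal) := by
    rw [EReal.coe_neg, he, ← sub_eq_add_neg]
    rfl
  have htop (z : Z) : GME Ψ B z ≠ ⊤ ↔ Ψ z ≠ ⊤ := by
    rw [hGME]
    exact EReal.add_ne_top_iff_ne_top_left (EReal.coe_ne_bot _) (EReal.coe_ne_top _)
  have hL : Continuous Lm := Lm.continuous_of_finiteDimensional
  refine ⟨fun x => ?_, ⟨x₀, (htop _).2 hx₀⟩, Set.ext fun x => htop _, ?_, ?_⟩
  · rw [hGME]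
    exact EReal.add_ne_bot_iff.2 ⟨hΨbot _, EReal.coe_ne_bot _⟩
  · have hlsc : LowerSemicontinuous (GME Ψ B) := by
      have hneg : LowerSemicontinuous fun z => ((-e z : ℝ) : EReal) :=
        continuous_coe_real_ereal.comp_lowerSemicontinuous
          (continuous_neg.comp_upperSemicontinuous_antitone
            (upperSemicontinuous_of_coe_eq_moreauEnvelope he hΨbot) fun _ _ h => neg_le_neg h)
          EReal.coe_strictMono.monotone
      rw [funext hGME]
      exact hΨlsc.add' hneg fun z => EReal.continuousAt_add (.inr (EReal.coe_ne_bot _))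
        (.inr (EReal.coe_ne_top _))
    exact hlsc.comp hL
  · have hconv := (hΨconv.add_coe
      (convexOn_half_sq_norm_sub_of_coe_eq_moreauEnvelope he hΨbot)).comp_linearMap Lm
    convert hconv using 2 with x
    have hq : qForm (LinearMap.adjoint Lm ∘ₗ LinearMap.adjoint B ∘ₗ B ∘ₗ Lm) x
        = 1 / 2 * ‖B (Lm x)‖ ^ 2 := by
      simp [qForm, LinearMap.adjoint_inner_left]
    rw [hGME, hq, add_assoc, ← EReal.coe_add, neg_add_eq_sub]
end
end

section
/- In the GME model setting, suppose Λ is a self-adjoint positive semidefinite linear operator on Y such that f − q_Λ is convex and such that A*ΛA − μ𝔏*B*B𝔏 is positive semidefinite. Then 𝔡(x) := f(Ax) − (μ/2)‖B𝔏x‖² is a real-valued convex function on X, and the cost function J = f∘A + μ(Ψ_B∘𝔏) is proper, lower semicontinuous and convex, with dom J = dom(Ψ∘𝔏). -/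
open scoped Pointwise RealInnerProductSpace

noncomputable section

/-- The cost function `J(x) = f(Ax) + μ Ψ_B(𝔏x)`. -/
noncomputable def Jcost {X Y Z Z' : Type*}
    [NormedAddCommGroup X] [InnerProductSpace ℝ X]
    [NormedAddCommGroup Y] [InnerProductSpace ℝ Y]
    [NormedAddCommGroup Z] [InnerProductSpace ℝ Z]
    [NormedAddCommGroup Z'] [InnerProductSpace ℝ Z']
    (A : X →ₗ[ℝ] Y) (Lm : X →ₗ[ℝ] Z) (B : Z →ₗ[ℝ] Z')
    (f : Y → ℝ) (Ψ : Z → EReal) (μ : ℝ) (x : X) : EReal :=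
  ((f (A x) : ℝ) : EReal) + (μ : EReal) * GME Ψ B (Lm x)

/-- A lower semicontinuous coercive function that never takes the value `⊥` is bounded below. -/
theorem exists_coe_le_of_lowerSemicontinuous_of_coercive {H : Type*} [NormedAddCommGroup H]
    [ProperSpace H] {φ : H → EReal} (hbot : ∀ z, φ z ≠ ⊥) (hlsc : LowerSemicontinuous φ)
    (hcoer : ECoercive φ) : ∃ m : ℝ, ∀ z, (m : EReal) ≤ φ z := by
  obtain ⟨R, hR⟩ := hcoer 0
  obtain ⟨z₀, -, hz₀⟩ := (hlsc.lowerSemicontinuousOn (Metric.closedBall 0 |R|)).exists_isMinOn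
    ⟨0, by simp⟩ (isCompact_closedBall 0 |R|)
  obtain ⟨m, hm⟩ : ∃ m : ℝ, (m : EReal) ≤ φ z₀ := by
    rcases EReal.lt_iff_exists_real_btwn.1 (bot_lt_iff_ne_bot.2 (hbot z₀)) with ⟨m, -, hm⟩
    exact ⟨m, hm.le⟩
  refine ⟨min m 0, fun z => ?_⟩
  rcases le_total R ‖z‖ with h | h
  · exact (EReal.coe_le_coe_iff.2 (min_le_right m 0)).trans (hR z h)
  · have hz : z ∈ Metric.closedBall (0 : H) |R| := by
      simpa using h.trans (le_abs_self R)
    exact (EReal.coe_le_coe_iff.2 (min_le_left m 0)).trans (hm.trans (hz₀ hz))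

section Envelope

variable {Z Z' : Type*} [NormedAddCommGroup Z] [InnerProductSpace ℝ Z]
  [NormedAddCommGroup Z'] [InnerProductSpace ℝ Z']

/-- The generalized Moreau envelope of a proper function bounded below is real-valued. -/
theorem exists_real_envelope {Ψ : Z → EReal} (hbdd : ∃ m : ℝ, ∀ z, (m : EReal) ≤ Ψ z)
    (hproper : ∃ z, Ψ z ≠ ⊤) (B : Z →ₗ[ℝ] Z') :
    ∃ e : Z → ℝ, ∀ z,
      (⨅ v : Z, (Ψ v + ((((1 : ℝ) / 2) * ‖B (z - v)‖ ^ 2 : ℝ) : EReal))) = (e z : EReal) := by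
  obtain ⟨m, hm⟩ := hbdd
  obtain ⟨v₀, hv₀⟩ := hproper
  refine ⟨fun z => (⨅ v : Z, (Ψ v + ((((1 : ℝ) / 2) * ‖B (z - v)‖ ^ 2 : ℝ) : EReal))).toReal,
    fun z => (EReal.coe_toReal ?_ ?_).symm⟩
  · exact ((iInf_le _ v₀).trans_lt (EReal.add_lt_top hv₀ (EReal.coe_ne_top _))).ne
  · refine ((EReal.bot_lt_coe m).trans_le (le_iInf fun v => (hm v).trans ?_)).ne'
    exact le_add_of_nonneg_right (EReal.coe_nonneg.2 (by positivity))

/-- Half the squared seminorm minus the generalized Moreau envelope is convex, being a supremum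
of affine functions. -/
theorem convexOn_half_sq_sub_envelope {Ψ : Z → EReal} (hbot : ∀ z, Ψ z ≠ ⊥) {B : Z →ₗ[ℝ] Z'}
    {e : Z → ℝ}
    (he : ∀ z, (⨅ v : Z, (Ψ v + ((((1 : ℝ) / 2) * ‖B (z - v)‖ ^ 2 : ℝ) : EReal))) =
      (e z : EReal)) :
    ConvexOn ℝ Set.univ (fun z => 1 / 2 * ‖B z‖ ^ 2 - e z) := by
  have hle (z v : Z) (r : ℝ) (hr : Ψ v = r) : e z ≤ r + 1 / 2 * ‖B (z - v)‖ ^ 2 := by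
    have := (he z).symm.le.trans (iInf_le _ v)
    rw [hr, ← EReal.coe_add, EReal.coe_le_coe_iff] at this
    exact this
  refine ⟨convex_univ, fun x _ y _ a b ha hb hab => ?_⟩
  have key : a * e x + b * e y + 1 / 2 * ‖B (a • x + b • y)‖ ^ 2
      - a * (1 / 2 * ‖B x‖ ^ 2) - b * (1 / 2 * ‖B y‖ ^ 2) ≤ e (a • x + b • y) := by
    rw [← EReal.coe_le_coe_iff, ← he]
    refine le_iInf fun v => ?_
    induction hv : Ψ v with
    | bot => exact absurd hv (hbot v)
    | top => rw [EReal.top_add_coe]; exact le_top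
    | coe r =>
      rw [← EReal.coe_add, EReal.coe_le_coe_iff]
      have h1 := mul_le_mul_of_nonneg_left (hle x v r hv) ha
      have h2 := mul_le_mul_of_nonneg_left (hle y v r hv) hb
      simp only [map_sub, map_add, map_smul, norm_sub_sq_real, inner_add_left,
        real_inner_smul_left] at h1 h2 ⊢
      obtain rfl : b = 1 - a := by linarith
      linarith
  simp only [smul_eq_mul]
  linarith

end Envelope

/-- The quadratic form of a linear operator with nonnegative quadratic form is convex. -/
theorem convexOn_qForm {H : Type*} [NormedAddCommGroup H] [InnerProductSpace ℝ H]
    {M : H →ₗ[ℝ] H} (hM : ∀ x, 0 ≤ ⟪M x, x⟫) : ConvexOn ℝ Set.univ (qForm M) := by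
  refine ⟨convex_univ, fun x _ y _ a b ha hb hab => ?_⟩
  have h := mul_nonneg (mul_nonneg ha hb) (hM (x - y))
  obtain rfl : b = 1 - a := by linarith
  simp only [qForm, map_add, map_sub, map_smul, inner_add_left, inner_add_right, inner_sub_left,
    inner_sub_right, real_inner_smul_left, real_inner_smul_right, smul_eq_mul] at h ⊢
  linarith

/-- Multiplication by a positive real preserves lower semicontinuity of `EReal`-valued functions. -/
theorem LowerSemicontinuous.coe_pos_mul {α : Type*} [TopologicalSpace α] {φ : α → EReal}
    (hφ : LowerSemicontinuous φ) {c : ℝ} (hc : 0 < c) :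
    LowerSemicontinuous fun x => (c : EReal) * φ x := by
  have hcont : Continuous fun t : EReal => (c : EReal) * t := by
    refine continuous_iff_continuousAt.2 fun t => ?_
    have hc' : (c : EReal) ≠ 0 := by exact_mod_cast hc.ne'
    exact EReal.Tendsto.mul tendsto_const_nhds Filter.tendsto_id (.inl hc') (.inl hc')
      (.inl (EReal.coe_ne_bot c)) (.inl (EReal.coe_ne_top c))
  exact hcont.comp_lowerSemicontinuous hφ fun s t hst =>
    mul_le_mul_of_nonneg_left hst (EReal.coe_nonneg.2 hc.le)

/-- The sum of a real convex function and a positive multiple of a convex function is convex. -/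
theorem EConvex.coe_add_coe_mul {H : Type*} [AddCommGroup H] [Module ℝ H] {φ : H → EReal}
    (hφ : EConvex φ) {g : H → ℝ} (hg : ConvexOn ℝ Set.univ g) {c : ℝ} (hc : 0 ≤ c) :
    EConvex fun x => (g x : EReal) + (c : EReal) * φ x := by
  intro x y a b ha hb hab
  have hg' : (g (a • x + b • y) : EReal) ≤ (a : EReal) * g x + (b : EReal) * g y := by
    exact_mod_cast hg.2 (Set.mem_univ x) (Set.mem_univ y) ha hb hab
  have hφ' := mul_le_mul_of_nonneg_left (hφ x y a b ha hb hab) (EReal.coe_nonneg.2 hc)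
  have distrib {r : ℝ} (hr : 0 ≤ r) (s t : EReal) : (r : EReal) * (s + t) = r * s + r * t :=
    EReal.left_distrib_of_nonneg_of_ne_top (EReal.coe_nonneg.2 hr) (EReal.coe_ne_top r) s t
  refine (add_le_add hg' hφ').trans_eq ?_
  rw [distrib ha, distrib hb, distrib hc, mul_left_comm (c : EReal) a, mul_left_comm (c : EReal) b]
  exact add_add_add_comm _ _ _ _

theorem stmt5
    {X Y Z Z' W : Type*}
    [NormedAddCommGroup X] [InnerProductSpace ℝ X] [FiniteDimensional ℝ X]
    [NormedAddCommGroup Y] [InnerProductSpace ℝ Y] [FiniteDimensional ℝ Y]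
    [NormedAddCommGroup Z] [InnerProductSpace ℝ Z] [FiniteDimensional ℝ Z]
    [NormedAddCommGroup Z'] [InnerProductSpace ℝ Z'] [FiniteDimensional ℝ Z']
    [NormedAddCommGroup W] [InnerProductSpace ℝ W] [FiniteDimensional ℝ W]
    (A : X →ₗ[ℝ] Y) (Lm : X →ₗ[ℝ] Z) (B : Z →ₗ[ℝ] Z') (Cm : X →ₗ[ℝ] W)
    (f : Y → ℝ) (hf : ConvexOn ℝ Set.univ f)
    (Ψ : Z → EReal) (hΨbot : ∀ z : Z, Ψ z ≠ ⊥) (hΨlsc : LowerSemicontinuous Ψ)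
    (hΨconv : EConvex Ψ) (hΨcoer : ECoercive Ψ)
    (μ : ℝ) (hμ : 0 < μ)
    (Δ : Set W) (hΔne : Δ.Nonempty) (hΔcl : IsClosed Δ) (hΔcv : Convex ℝ Δ)
    (hfeas : ∃ x : X, Ψ (Lm x) ≠ ⊤ ∧ Cm x ∈ Δ)
    (Λ : Y →ₗ[ℝ] Y) (hΛsym : Λ.IsSymmetric) (hΛpsd : ∀ y : Y, 0 ≤ ⟪Λ y, y⟫)
    (hrel : ConvexOn ℝ Set.univ (fun y : Y => f y - qForm Λ y))
    (hoc : ∀ x : X,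
      0 ≤ ⟪((LinearMap.adjoint A ∘ₗ Λ ∘ₗ A)
              - μ • (LinearMap.adjoint Lm ∘ₗ LinearMap.adjoint B ∘ₗ B ∘ₗ Lm)) x, x⟫) :
    ConvexOn ℝ Set.univ (fun x : X => f (A x) - μ / 2 * ‖B (Lm x)‖ ^ 2) ∧
    (∀ x : X, Jcost A Lm B f Ψ μ x ≠ ⊥) ∧
    (∃ x : X, Jcost A Lm B f Ψ μ x ≠ ⊤) ∧
    ({x : X | Jcost A Lm B f Ψ μ x ≠ ⊤} = {x : X | Ψ (Lm x) ≠ ⊤}) ∧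
    LowerSemicontinuous (Jcost A Lm B f Ψ μ) ∧
    EConvex (Jcost A Lm B f Ψ μ) := by
  have hd : ConvexOn ℝ Set.univ (fun x : X => f (A x) - μ / 2 * ‖B (Lm x)‖ ^ 2) := by
    have h := (hrel.comp_linearMap A).add (convexOn_qForm hoc)
    refine h.congr fun x _ => ?_
    simp only [Pi.add_apply, Function.comp_apply, qForm, LinearMap.sub_apply, LinearMap.smul_apply,
      LinearMap.comp_apply, inner_sub_left, real_inner_smul_left, LinearMap.adjoint_inner_left,
      real_inner_self_eq_norm_sq]
    ring
  obtain ⟨x₀, hx₀, -⟩ := hfeas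
  obtain ⟨e, he⟩ := exists_real_envelope
    (exists_coe_le_of_lowerSemicontinuous_of_coercive hΨbot hΨlsc hΨcoer) ⟨_, hx₀⟩ B
  set g : X → ℝ := fun x => f (A x) - μ * e (Lm x)
  have hg : ConvexOn ℝ Set.univ g := by
    have h := hd.add
      (((convexOn_half_sq_sub_envelope hΨbot he).comp_linearMap Lm).smul hμ.le)
    refine h.congr fun x _ => ?_
    simp only [Pi.add_apply, Function.comp_apply, smul_eq_mul, g]
    ring
  have hJ : Jcost A Lm B f Ψ μ = fun x => (g x : EReal) + (μ : EReal) * Ψ (Lm x) := by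
    funext x
    simp only [Jcost, GME, he, g]
    induction hx : Ψ (Lm x) with
    | bot => exact absurd hx (hΨbot _)
    | top => simp only [EReal.top_sub_coe, EReal.coe_mul_top_of_pos hμ, EReal.coe_add_top]
    | coe r => norm_cast; ring
  have hJtop (x : X) : Jcost A Lm B f Ψ μ x ≠ ⊤ ↔ Ψ (Lm x) ≠ ⊤ := by
    rw [hJ]
    induction hx : Ψ (Lm x) with
    | bot => exact absurd hx (hΨbot _)
    | top => simp [hx, EReal.coe_mul_top_of_pos hμ]
    | coe r =>
      simp only [hx]
      exact iff_of_true (EReal.coe_ne_top (g x + μ * r)) (EReal.coe_ne_top r)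
  have hmul (x : X) : (μ : EReal) * Ψ (Lm x) ≠ ⊥ := by
    induction hx : Ψ (Lm x) with
    | bot => exact absurd hx (hΨbot _)
    | top => simp [EReal.coe_mul_top_of_pos hμ]
    | coe r => exact EReal.coe_ne_bot (μ * r)
  refine ⟨hd, fun x => ?_, ⟨x₀, (hJtop x₀).2 hx₀⟩, Set.ext hJtop, ?_, ?_⟩
  · rw [hJ]
    exact EReal.add_ne_bot_iff.2 ⟨EReal.coe_ne_bot _, hmul x⟩
  · rw [hJ]
    have hgc : Continuous g := continuousOn_univ.1 (hg.continuousOn isOpen_univ)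
    exact (continuous_coe_real_ereal.comp hgc).lowerSemicontinuous.add'
      ((hΨlsc.comp Lm.continuous_of_finiteDimensional).coe_pos_mul hμ)
      fun x => EReal.continuousAt_add (.inl (EReal.coe_ne_top _)) (.inl (EReal.coe_ne_bot _))
  · rw [hJ]
    refine EConvex.coe_add_coe_mul (fun x y a b ha hb hab => ?_) hg hμ.le
    simpa using hΨconv (Lm x) (Lm y) a b ha hb hab
end
end

section
/- In the GME model setting, assume condition (C1): the function 𝔡(x) := f(Ax) − (μ/2)‖B𝔏x‖² is convex on X. Then for every x ∈ X with rec(f∘A)(x) < ∞ one has B𝔏x = 0; that is, dom(rec(f∘A)) ⊆ null(B𝔏). -/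
open scoped Pointwise RealInnerProductSpace

noncomputable section

/-- Recession function `rec(φ)(x) = sup_{v ∈ dom φ} (φ(v + x) − φ(v))`. -/
noncomputable def erec {H : Type*} [AddCommGroup H] (φ : H → EReal) (x : H) : EReal :=
  ⨆ v ∈ {v : H | φ v ≠ ⊤}, (φ (v + x) - φ v)

/-- Increments of a convex function along a ray dominate the initial increment. -/
theorem ConvexOn.add_smul_le {E : Type*} [AddCommGroup E] [Module ℝ E] {d : E → ℝ}
    (hd : ConvexOn ℝ Set.univ d) (x : E) {t : ℝ} (ht : 0 ≤ t) :
    d x + d (t • x) ≤ d 0 + d (t • x + x) := by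
  have hpos : 0 < t + 1 := by linarith
  have ha : 0 ≤ t / (t + 1) := by positivity
  have hb : 0 ≤ 1 / (t + 1) := by positivity
  have hab : t / (t + 1) + 1 / (t + 1) = 1 := by field_simp
  have e : t • x + x = (t + 1) • x := by rw [add_smul, one_smul]
  have h1 := hd.2 (Set.mem_univ 0) (Set.mem_univ ((t + 1) • x)) ha hb hab
  have h2 := hd.2 (Set.mem_univ ((t + 1) • x)) (Set.mem_univ 0) ha hb hab
  rw [smul_zero, zero_add, smul_smul, one_div_mul_cancel hpos.ne', one_smul] at h1
  rw [smul_zero, add_zero, smul_smul, div_mul_cancel₀ t hpos.ne'] at h2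
  simp only [smul_eq_mul] at h1 h2
  rw [e]
  calc d x + d (t • x)
      ≤ (t / (t + 1) + 1 / (t + 1)) * (d 0 + d ((t + 1) • x)) := by linarith
    _ = d 0 + d ((t + 1) • x) := by rw [hab, one_mul]

/-- A finite value of the recession function of a real-valued function bounds all increments. -/
theorem exists_forall_sub_le_of_erec_ne_top {H : Type*} [AddCommGroup H] [Module ℝ H]
    {g : H → ℝ} {x : H} (h : erec (fun y => ((g y : ℝ) : EReal)) x ≠ ⊤) :
    ∃ C : ℝ, ∀ v, g (v + x) - g v ≤ C := by
  refine ⟨(erec (fun y => ((g y : ℝ) : EReal)) x).toReal, fun v => ?_⟩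
  have hle : ((g (v + x) - g v : ℝ) : EReal) ≤ erec (fun y => ((g y : ℝ) : EReal)) x := by
    rw [EReal.coe_sub]
    exact le_iSup₂ (f := fun (v : H) (_ : v ∈ {v : H | ((g v : ℝ) : EReal) ≠ ⊤}) =>
      ((g (v + x) : ℝ) : EReal) - ((g v : ℝ) : EReal)) v (EReal.coe_ne_top _)
  exact EReal.coe_le_coe_iff.1 (hle.trans (EReal.le_coe_toReal h))

theorem stmt6
    {X Y Z Z' W : Type*}
    [NormedAddCommGroup X] [InnerProductSpace ℝ X] [FiniteDimensional ℝ X]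
    [NormedAddCommGroup Y] [InnerProductSpace ℝ Y] [FiniteDimensional ℝ Y]
    [NormedAddCommGroup Z] [InnerProductSpace ℝ Z] [FiniteDimensional ℝ Z]
    [NormedAddCommGroup Z'] [InnerProductSpace ℝ Z'] [FiniteDimensional ℝ Z']
    [NormedAddCommGroup W] [InnerProductSpace ℝ W] [FiniteDimensional ℝ W]
    (A : X →ₗ[ℝ] Y) (Lm : X →ₗ[ℝ] Z) (B : Z →ₗ[ℝ] Z') (Cm : X →ₗ[ℝ] W)
    (f : Y → ℝ) (hf : ConvexOn ℝ Set.univ f)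
    (Ψ : Z → EReal) (hΨbot : ∀ z : Z, Ψ z ≠ ⊥) (hΨlsc : LowerSemicontinuous Ψ)
    (hΨconv : EConvex Ψ) (hΨcoer : ECoercive Ψ)
    (μ : ℝ) (hμ : 0 < μ)
    (Δ : Set W) (hΔne : Δ.Nonempty) (hΔcl : IsClosed Δ) (hΔcv : Convex ℝ Δ)
    (hfeas : ∃ x : X, Ψ (Lm x) ≠ ⊤ ∧ Cm x ∈ Δ)
    (hC1 : ConvexOn ℝ Set.univ (fun x : X => f (A x) - μ / 2 * ‖B (Lm x)‖ ^ 2))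
    :
    ∀ x : X, erec (fun x' : X => ((f (A x') : ℝ) : EReal)) x ≠ ⊤ → B (Lm x) = 0 := by
  intro x hx
  obtain ⟨C, hC⟩ := exists_forall_sub_le_of_erec_ne_top (g := fun x' => f (A x')) hx
  by_contra hne
  have hb : 0 < ‖B (Lm x)‖ := norm_pos_iff.2 hne
  set b := ‖B (Lm x)‖ with hbdef
  have hc : 0 < μ * b ^ 2 := by positivity
  set K := C - (f (A x) - μ / 2 * b ^ 2) + f (A 0) with hK
  set t := |K| / (μ * b ^ 2) with htdef
  have ht : 0 ≤ t := by positivity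
  have htK : μ * b ^ 2 * t = |K| := mul_div_cancel₀ _ hc.ne'
  have key := hC1.add_smul_le x ht
  have n1 : ‖B (Lm (t • x))‖ = t * b := by
    rw [map_smul, map_smul, norm_smul, Real.norm_of_nonneg ht]
  have n2 : ‖B (Lm (t • x + x))‖ = (t + 1) * b := by
    rw [show t • x + x = (t + 1) • x by rw [add_smul, one_smul], map_smul, map_smul, norm_smul,
      Real.norm_of_nonneg (by linarith)]
  have n0 : ‖B (Lm 0)‖ = 0 := by simp
  simp only [n0, n1, n2, ← hbdef] at key
  have hCt := hC (t • x)
  nlinarith [le_abs_self K]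
end
end

section
/- In the GME model setting, assume condition (C1) (𝔡(x) := f(Ax) − (μ/2)‖B𝔏x‖² is convex on X) and that f∘A is bounded below on X. Then for every x ∈ X: (i) rec(J)(x) ≥ rec(f∘A)(x) ≥ 0; (ii) rec(J)(x) > 0 if and only if rec(f∘A)(x) > 0 or 𝔏x ≠ 0; (iii) rec(J)(x) = 0 if and only if rec(f∘A)(x) = 0 and 𝔏x = 0. -/
open scoped Pointwise RealInnerProductSpace

noncomputable section

/-- Iterating the bound defining the recession function along a ray. -/
lemma le_add_nsmul_of_erec_le {H : Type*} [AddCommGroup H] [Module ℝ H] {φ : H → EReal}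
    {x v : H} {a r : ℝ} (hbot : ∀ y, φ y ≠ ⊥) (hv : φ v ≤ (a : EReal))
    (hr : erec φ x ≤ (r : EReal)) (n : ℕ) :
    φ (v + (n : ℝ) • x) ≤ ((a + n * r : ℝ) : EReal) := by
  induction n with
  | zero => simpa using hv
  | succ n ih =>
    have htop : φ (v + (n : ℝ) • x) ≠ ⊤ := ne_top_of_le_ne_top (EReal.coe_ne_top _) ih
    have hstep : φ (v + (n : ℝ) • x + x) - φ (v + (n : ℝ) • x) ≤ (r : EReal) :=
      (le_iSup₂ (f := fun w (_ : w ∈ {w : H | φ w ≠ ⊤}) => φ (w + x) - φ w)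
        (v + (n : ℝ) • x) htop).trans hr
    have heq : v + ((n + 1 : ℕ) : ℝ) • x = v + (n : ℝ) • x + x := by
      push_cast
      module
    rw [heq]
    obtain ⟨p, hp⟩ : ∃ p : ℝ, φ (v + (n : ℝ) • x) = p :=
      ⟨_, (EReal.coe_toReal htop (hbot _)).symm⟩
    rw [hp] at hstep ih
    have h1 := EReal.sub_le_iff_le_add (Or.inl (EReal.coe_ne_bot p))
      (Or.inl (EReal.coe_ne_top p)) |>.1 hstep
    refine h1.trans ?_
    rw [← EReal.coe_add, EReal.coe_le_coe_iff]
    rw [EReal.coe_le_coe_iff] at ih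
    push_cast
    linarith

/-- A linear bound along one ray bounds the recession function of a finite convex function. -/
lemma erec_coe_le_of_ray_le {H : Type*} [NormedAddCommGroup H] [NormedSpace ℝ H]
    [FiniteDimensional ℝ H] {g : H → ℝ} (hg : ConvexOn ℝ Set.univ g) {x v : H} {a r : ℝ}
    (hray : ∀ n : ℕ, g (v + (n : ℝ) • x) ≤ a + n * r) :
    erec (fun y => (g y : EReal)) x ≤ (r : EReal) := by
  refine iSup₂_le fun w _ => ?_
  rw [← EReal.coe_sub, EReal.coe_le_coe_iff, sub_le_iff_le_add]
  have hcont : Continuous g := by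
    simpa [continuousOn_univ] using hg.continuousOn isOpen_univ
  have hlim : Filter.Tendsto (fun n : ℕ => (1 : ℝ) / ((n : ℝ) + 1)) Filter.atTop (nhds 0) :=
    tendsto_one_div_add_atTop_nhds_zero_nat
  have hleft : Filter.Tendsto
      (fun n : ℕ => g (w + x + ((1 : ℝ) / ((n : ℝ) + 1)) • (v - w))) Filter.atTop
      (nhds (g (w + x))) := by
    have h : Continuous fun t : ℝ => g (w + x + t • (v - w)) := by fun_prop
    simpa [Function.comp_def] using (h.tendsto 0).comp hlim
  have hright : Filter.Tendsto
      (fun n : ℕ => (1 - (1 : ℝ) / ((n : ℝ) + 1)) * g w + (1 : ℝ) / ((n : ℝ) + 1) * a + r)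
      Filter.atTop (nhds (r + g w)) := by
    have h : Continuous fun t : ℝ => (1 - t) * g w + t * a + r := by fun_prop
    simpa [Function.comp_def, add_comm] using (h.tendsto 0).comp hlim
  refine le_of_tendsto_of_tendsto' hleft hright fun n => ?_
  have hn : (0 : ℝ) < (n : ℝ) + 1 := by positivity
  have hle : (1 : ℝ) / ((n : ℝ) + 1) ≤ 1 := by
    rw [div_le_one hn]
    linarith [(Nat.cast_nonneg n : (0 : ℝ) ≤ n)]
  have hconv := hg.2 (Set.mem_univ w) (Set.mem_univ (v + ((n + 1 : ℕ) : ℝ) • x))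
    (sub_nonneg.2 hle) (one_div_pos.2 hn).le (by ring)
  have hpt : (1 - (1 : ℝ) / ((n : ℝ) + 1)) • w +
      ((1 : ℝ) / ((n : ℝ) + 1)) • (v + ((n + 1 : ℕ) : ℝ) • x) =
      w + x + ((1 : ℝ) / ((n : ℝ) + 1)) • (v - w) := by
    push_cast
    match_scalars <;> field_simp
    ring
  rw [hpt] at hconv
  refine hconv.trans ?_
  have h2 := mul_le_mul_of_nonneg_left (hray (n + 1)) (one_div_pos.2 hn).le
  have h3 : (1 : ℝ) / ((n : ℝ) + 1) * (a + ((n + 1 : ℕ) : ℝ) * r) =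
      1 / ((n : ℝ) + 1) * a + r := by
    push_cast
    field_simp
  simp only [smul_eq_mul]
  linarith

/-- The recession function of a finite function bounded below is nonnegative. -/
lemma erec_coe_nonneg_of_bddBelow {H : Type*} [AddCommGroup H] [Module ℝ H] {g : H → ℝ} {c : ℝ}
    (hc : ∀ y, c ≤ g y) (x : H) : 0 ≤ erec (fun y => (g y : EReal)) x := by
  refine EReal.le_of_forall_lt_iff_le.1 fun r hr => ?_
  by_contra! hneg
  have hneg' : r < 0 := by exact_mod_cast hneg
  obtain ⟨n, hn⟩ := exists_nat_gt ((g 0 - c) / (-r))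
  have h := le_add_nsmul_of_erec_le (φ := fun y => (g y : EReal)) (v := 0) (a := g 0)
    (fun _ => EReal.coe_ne_bot _) le_rfl hr.le n
  rw [EReal.coe_le_coe_iff] at h
  rw [div_lt_iff₀ (by linarith)] at hn
  linarith [hc (0 + (n : ℝ) • x)]

/-- A coercive lower semicontinuous function avoiding `⊥` is bounded below. -/
lemma ECoercive.exists_coe_le {H : Type*} [NormedAddCommGroup H] [NormedSpace ℝ H]
    [FiniteDimensional ℝ H] {φ : H → EReal} (hcoer : ECoercive φ) (hlsc : LowerSemicontinuous φ)
    (hbot : ∀ z, φ z ≠ ⊥) : ∃ m : ℝ, ∀ z, (m : EReal) ≤ φ z := by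
  obtain ⟨R, hR⟩ := hcoer 0
  have hcomp : IsCompact (Metric.closedBall (0 : H) |R|) := isCompact_closedBall _ _
  obtain ⟨z₀, -, hz₀⟩ := LowerSemicontinuousOn.exists_isMinOn
    ⟨0, Metric.mem_closedBall_self (abs_nonneg R)⟩ hcomp (hlsc.lowerSemicontinuousOn _)
  obtain ⟨m, hm⟩ : ∃ m : ℝ, (m : EReal) ≤ φ z₀ := by
    obtain ⟨m, -, hm⟩ := EReal.lt_iff_exists_real_btwn.1 (bot_lt_iff_ne_bot.2 (hbot z₀))
    exact ⟨m, hm.le⟩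
  refine ⟨min m 0, fun z => ?_⟩
  by_cases hz : R ≤ ‖z‖
  · exact (EReal.coe_le_coe_iff.2 (min_le_right m 0)).trans (hR z hz)
  · have hmem : z ∈ Metric.closedBall (0 : H) |R| := by
      rw [mem_closedBall_zero_iff]
      exact (not_le.1 hz).le.trans (le_abs_self R)
    exact (EReal.coe_le_coe_iff.2 (min_le_left m 0)).trans (hm.trans (hz₀ hmem))

/-- The generalized Moreau envelope is a real-valued minorant, invariant along `ker B`. -/
lemma exists_real_envelope_s7 {Z Z' : Type*} [NormedAddCommGroup Z] [InnerProductSpace ℝ Z]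
    [NormedAddCommGroup Z'] [InnerProductSpace ℝ Z'] {Ψ : Z → EReal} (B : Z →ₗ[ℝ] Z') {m : ℝ}
    (hm : ∀ z, (m : EReal) ≤ Ψ z) {z₀ : Z} (hz₀ : Ψ z₀ ≠ ⊤) :
    ∃ e : Z → ℝ, (∀ z, GME Ψ B z = Ψ z - (e z : EReal)) ∧ (∀ z, (e z : EReal) ≤ Ψ z) ∧
      ∀ z w, B w = 0 → e (z + w) = e z := by
  set E : Z → EReal := fun z =>
    ⨅ v : Z, (Ψ v + ((((1 : ℝ) / 2) * ‖B (z - v)‖ ^ 2 : ℝ) : EReal)) with hE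
  have hEbot : ∀ z, E z ≠ ⊥ := fun z => by
    refine ne_bot_of_le_ne_bot (EReal.coe_ne_bot m) (le_iInf fun v => ?_)
    calc (m : EReal) = m + ((0 : ℝ) : EReal) := by simp
      _ ≤ _ := add_le_add (hm v) (EReal.coe_le_coe_iff.2 (by positivity))
  have hEtop : ∀ z, E z ≠ ⊤ := fun z =>
    ne_top_of_le_ne_top (EReal.add_ne_top hz₀ (EReal.coe_ne_top _)) (iInf_le _ z₀)
  have hcoe : ∀ z, ((E z).toReal : EReal) = E z := fun z => EReal.coe_toReal (hEtop z) (hEbot z)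
  refine ⟨fun z => (E z).toReal, fun z => ?_, fun z => ?_, fun z w hw => ?_⟩
  · rw [hcoe]
    rfl
  · rw [hcoe]
    exact (iInf_le _ z).trans (by simp)
  · have h : E (z + w) = E z := by
      simp only [hE, map_sub, map_add, hw, add_zero]
    simp only [h]

/-- Strong convexity along a ray is incompatible with two-sided bounds there. -/
lemma eq_zero_of_bounded_of_convexOn_sub_sq {H E : Type*} [AddCommGroup H] [Module ℝ H]
    [NormedAddCommGroup E] [InnerProductSpace ℝ E] {g : H → ℝ} (T : H →ₗ[ℝ] E) {μ c M : ℝ}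
    (hμ : 0 < μ) (hconv : ConvexOn ℝ Set.univ fun y => g y - μ / 2 * ‖T y‖ ^ 2)
    (hc : ∀ y, c ≤ g y) {v x : H} (hM : ∀ n : ℕ, g (v + (n : ℝ) • x) ≤ M) : T x = 0 := by
  by_contra hne
  have hpos : 0 < μ / 2 * ‖T x‖ ^ 2 := by positivity
  obtain ⟨n, hn⟩ := exists_nat_gt ((M - c) / (μ / 2 * ‖T x‖ ^ 2))
  rw [div_lt_iff₀ hpos] at hn
  have hmid := hconv.2 (Set.mem_univ v) (Set.mem_univ (v + ((2 * n : ℕ) : ℝ) • x))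
    (by norm_num : (0 : ℝ) ≤ 1 / 2) (by norm_num : (0 : ℝ) ≤ 1 / 2) (by norm_num)
  have hpt : (1 / 2 : ℝ) • v + (1 / 2 : ℝ) • (v + ((2 * n : ℕ) : ℝ) • x) =
      v + (n : ℝ) • x := by
    push_cast
    module
  simp only [hpt, smul_eq_mul] at hmid
  have hsq : ∀ t : ℝ, ‖T (v + t • x)‖ ^ 2 =
      ‖T v‖ ^ 2 + 2 * t * ⟪T v, T x⟫ + t ^ 2 * ‖T x‖ ^ 2 := fun t => by
    rw [map_add, map_smul, norm_add_sq_real, norm_smul, real_inner_smul_right, mul_pow,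
      Real.norm_eq_abs, sq_abs]
    ring
  rw [hsq, hsq] at hmid
  push_cast at hmid
  have h0 := hM 0
  have h2 := hM (2 * n)
  push_cast at h2
  simp only [Nat.cast_zero, zero_smul, add_zero] at h0
  have hn2 : (n : ℝ) ≤ (n : ℝ) ^ 2 := by
    exact_mod_cast Nat.le_self_pow two_ne_zero n
  have hn3 := mul_le_mul_of_nonneg_right hn2 hpos.le
  have hcn := hc (v + (n : ℝ) • x)
  nlinarith

theorem stmt7
    {X Y Z Z' W : Type*}
    [NormedAddCommGroup X] [InnerProductSpace ℝ X] [FiniteDimensional ℝ X]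
    [NormedAddCommGroup Y] [InnerProductSpace ℝ Y] [FiniteDimensional ℝ Y]
    [NormedAddCommGroup Z] [InnerProductSpace ℝ Z] [FiniteDimensional ℝ Z]
    [NormedAddCommGroup Z'] [InnerProductSpace ℝ Z'] [FiniteDimensional ℝ Z']
    [NormedAddCommGroup W] [InnerProductSpace ℝ W] [FiniteDimensional ℝ W]
    (A : X →ₗ[ℝ] Y) (Lm : X →ₗ[ℝ] Z) (B : Z →ₗ[ℝ] Z') (Cm : X →ₗ[ℝ] W)
    (f : Y → ℝ) (hf : ConvexOn ℝ Set.univ f)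
    (Ψ : Z → EReal) (hΨbot : ∀ z : Z, Ψ z ≠ ⊥) (hΨlsc : LowerSemicontinuous Ψ)
    (hΨconv : EConvex Ψ) (hΨcoer : ECoercive Ψ)
    (μ : ℝ) (hμ : 0 < μ)
    (Δ : Set W) (hΔne : Δ.Nonempty) (hΔcl : IsClosed Δ) (hΔcv : Convex ℝ Δ)
    (hfeas : ∃ x : X, Ψ (Lm x) ≠ ⊤ ∧ Cm x ∈ Δ)
    (hC1 : ConvexOn ℝ Set.univ (fun x : X => f (A x) - μ / 2 * ‖B (Lm x)‖ ^ 2))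
    (hbdd : ∃ c : ℝ, ∀ x : X, c ≤ f (A x)) :
    ∀ x : X,
      (erec (fun x' : X => ((f (A x') : ℝ) : EReal)) x ≤ erec (Jcost A Lm B f Ψ μ) x ∧
        (0 : EReal) ≤ erec (fun x' : X => ((f (A x') : ℝ) : EReal)) x) ∧
      ((0 : EReal) < erec (Jcost A Lm B f Ψ μ) x ↔
        (0 : EReal) < erec (fun x' : X => ((f (A x') : ℝ) : EReal)) x ∨ Lm x ≠ 0) ∧
      (erec (Jcost A Lm B f Ψ μ) x = 0 ↔
        erec (fun x' : X => ((f (A x') : ℝ) : EReal)) x = 0 ∧ Lm x = 0) := by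
  obtain ⟨c, hc⟩ := hbdd
  obtain ⟨v, hv, -⟩ := hfeas
  obtain ⟨m, hm⟩ := hΨcoer.exists_coe_le hΨlsc hΨbot
  obtain ⟨e, hGME, heΨ, heB⟩ := exists_real_envelope_s7 B hm hv
  have hg : ConvexOn ℝ Set.univ fun y => f (A y) := by
    exact hf.comp_linearMap A
  have hJtop : ∀ y, Ψ (Lm y) = ⊤ → Jcost A Lm B f Ψ μ y = ⊤ := fun y hy => by
    rw [Jcost, hGME, hy, EReal.top_sub_coe, EReal.coe_mul_top_of_pos hμ, EReal.coe_add_top]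
  have hJcoe : ∀ y (p : ℝ), Ψ (Lm y) = p →
      Jcost A Lm B f Ψ μ y = ((f (A y) + μ * (p - e (Lm y)) : ℝ) : EReal) := fun y p hy => by
    rw [Jcost, hGME, hy]
    norm_cast
  have hfinite : ∀ y, Ψ (Lm y) ≠ ⊤ → ∃ p : ℝ, Ψ (Lm y) = p := fun y hy =>
    ⟨_, (EReal.coe_toReal hy (hΨbot _)).symm⟩
  have hJge : ∀ y, (f (A y) : EReal) ≤ Jcost A Lm B f Ψ μ y := fun y => by
    by_cases hy : Ψ (Lm y) = ⊤
    · simp [hJtop y hy]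
    · obtain ⟨p, hp⟩ := hfinite y hy
      have hep := heΨ (Lm y)
      rw [hp, EReal.coe_le_coe_iff] at hep
      rw [hJcoe y p hp, EReal.coe_le_coe_iff]
      have := mul_nonneg hμ.le (sub_nonneg.2 hep)
      linarith
  have hJbot : ∀ y, Jcost A Lm B f Ψ μ y ≠ ⊥ := fun y =>
    ne_bot_of_le_ne_bot (EReal.coe_ne_bot _) (hJge y)
  obtain ⟨p, hp⟩ := hfinite v hv
  set a : ℝ := f (A v) + μ * (p - e (Lm v)) with ha
  have hJv : Jcost A Lm B f Ψ μ v ≤ (a : EReal) := (hJcoe v p hp).le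
  intro x
  have hnonneg : (0 : EReal) ≤ erec (fun x' : X => ((f (A x') : ℝ) : EReal)) x :=
    erec_coe_nonneg_of_bddBelow (g := fun y => f (A y)) hc x
  have hle : erec (fun x' : X => ((f (A x') : ℝ) : EReal)) x ≤
      erec (Jcost A Lm B f Ψ μ) x := by
    refine EReal.le_of_forall_lt_iff_le.1 fun r hr => ?_
    refine erec_coe_le_of_ray_le (v := v) (a := a) hg fun n => ?_
    exact EReal.coe_le_coe_iff.1
      ((hJge _).trans (le_add_nsmul_of_erec_le hJbot hJv hr.le n))
  have hpos : Lm x ≠ 0 → 0 < erec (Jcost A Lm B f Ψ μ) x := fun hx => by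
    by_contra! hnp
    have hray : ∀ n : ℕ, Jcost A Lm B f Ψ μ (v + (n : ℝ) • x) ≤ (a : EReal) := fun n => by
      simpa using le_add_nsmul_of_erec_le (r := 0) hJbot hJv hnp n
    have hBL : B (Lm x) = 0 := eq_zero_of_bounded_of_convexOn_sub_sq (B ∘ₗ Lm) hμ hC1 hc
      fun n => EReal.coe_le_coe_iff.1 ((hJge _).trans (hray n))
    obtain ⟨R, hR⟩ := hΨcoer (e (Lm v) + (a - c) / μ + 1)
    have hxpos : 0 < ‖Lm x‖ := norm_pos_iff.2 hx
    obtain ⟨n, hn⟩ := exists_nat_gt ((R + ‖Lm v‖) / ‖Lm x‖)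
    rw [div_lt_iff₀ hxpos] at hn
    have hLn : Lm (v + (n : ℝ) • x) = Lm v + (n : ℝ) • Lm x := by simp
    have hnorm : R ≤ ‖Lm (v + (n : ℝ) • x)‖ := by
      have h := norm_sub_norm_le ((n : ℝ) • Lm x) (-Lm v)
      rw [norm_neg, norm_smul, Real.norm_natCast, sub_neg_eq_add, add_comm (_ • _)] at h
      rw [hLn]
      linarith
    have hbig := hR _ hnorm
    have hnt : Ψ (Lm (v + (n : ℝ) • x)) ≠ ⊤ := fun h => by
      have := hray n
      rw [hJtop _ h] at this
      exact EReal.coe_ne_top a (top_le_iff.1 this)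
    obtain ⟨q, hq⟩ := hfinite _ hnt
    have hlast := hray n
    rw [hJcoe _ q hq, EReal.coe_le_coe_iff, hLn, heB _ _ (by simp [hBL])] at hlast
    rw [hq, EReal.coe_le_coe_iff] at hbig
    have hmul : μ * ((a - c) / μ + 1) ≤ μ * (q - e (Lm v)) :=
      mul_le_mul_of_nonneg_left (by linarith) hμ.le
    rw [mul_add, mul_div_cancel₀ _ hμ.ne', mul_one] at hmul
    linarith [hc (v + (n : ℝ) • x)]
  have hker : Lm x = 0 → erec (Jcost A Lm B f Ψ μ) x ≤
      erec (fun x' : X => ((f (A x') : ℝ) : EReal)) x := fun hx => by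
    refine iSup₂_le fun w hw => ?_
    obtain ⟨q, hq⟩ := hfinite w fun h => hw (hJtop w h)
    have hLw : Lm (w + x) = Lm w := by simp [hx]
    refine le_trans (le_of_eq ?_)
      (le_iSup₂ (f := fun u (_ : u ∈ {u : X | ((f (A u) : ℝ) : EReal) ≠ ⊤}) =>
        ((f (A (u + x)) : ℝ) : EReal) - ((f (A u) : ℝ) : EReal)) w (EReal.coe_ne_top _))
    rw [hJcoe w q hq, hJcoe (w + x) q (by rw [hLw, hq]), hLw, ← EReal.coe_sub, ← EReal.coe_sub]
    congr 1
    ring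
  have hiff : (0 : EReal) < erec (Jcost A Lm B f Ψ μ) x ↔
      (0 : EReal) < erec (fun x' : X => ((f (A x') : ℝ) : EReal)) x ∨ Lm x ≠ 0 := by
    refine ⟨fun h => ?_, fun h => h.elim (fun h => h.trans_le hle) hpos⟩
    by_cases hx : Lm x = 0
    · exact Or.inl (h.trans_le (hker hx))
    · exact Or.inr hx
  refine ⟨⟨hle, hnonneg⟩, hiff, fun h => ?_, fun ⟨h, hx⟩ => ?_⟩
  · refine ⟨le_antisymm (hle.trans h.le) hnonneg, ?_⟩
    by_contra hx
    exact (hpos hx).ne' h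
  · exact le_antisymm ((hker hx).trans h.le) (hnonneg.trans hle)
end
end

section
/- In the GME model setting, assume condition (C1) (𝔡(x) := f(Ax) − (μ/2)‖B𝔏x‖² is convex on X). If either (i) f is coercive and null A ∩ null 𝔏 = {0}, or (ii) f is bounded below and null 𝔏 = {0}, then J is coercive, i.e. J(x) → ∞ as ‖x‖ → ∞ (equivalently, rec(J)(x) > 0 for every x ≠ 0). -/
open scoped Pointwise RealInnerProductSpace

noncomputable section

/-- Coercivity for real-valued functions. -/
def RCoercive {H : Type*} [NormedAddCommGroup H] (φ : H → ℝ) : Prop :=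
  ∀ C : ℝ, ∃ R : ℝ, ∀ x : H, R ≤ ‖x‖ → C ≤ φ x

/-- A ray with nonzero direction leaves every ball. -/
theorem exists_le_norm_add_smul {E : Type*} [NormedAddCommGroup E] [NormedSpace ℝ E]
    (a : E) {w : E} (hw : w ≠ 0) (R : ℝ) : ∃ t : ℝ, 0 ≤ t ∧ R ≤ ‖a + t • w‖ := by
  have hw' : 0 < ‖w‖ := norm_pos_iff.2 hw
  refine ⟨(|R| + ‖a‖) / ‖w‖, by positivity, ?_⟩
  set t : ℝ := (|R| + ‖a‖) / ‖w‖ with ht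
  have ht0 : 0 ≤ t := by positivity
  have h1 : ‖t • w‖ = |R| + ‖a‖ := by
    rw [norm_smul, Real.norm_of_nonneg ht0, ht, div_mul_cancel₀ _ hw'.ne']
  have h2 : ‖t • w‖ ≤ ‖a + t • w‖ + ‖a‖ := by
    have := norm_sub_le (a + t • w) a
    rwa [add_sub_cancel_left] at this
  linarith [le_abs_self R]

/-- An unbounded closed convex set in finite dimension contains a ray from each of its points. -/
theorem exists_ray_of_unbounded {E : Type*} [NormedAddCommGroup E] [NormedSpace ℝ E]
    [FiniteDimensional ℝ E] {S : Set E} (hcl : IsClosed S) (hcv : Convex ℝ S)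
    (hunb : ∀ R : ℝ, ∃ x ∈ S, R ≤ ‖x‖) {x₀ : E} (hx₀ : x₀ ∈ S) :
    ∃ d : E, d ≠ 0 ∧ ∀ t : ℝ, 0 ≤ t → x₀ + t • d ∈ S := by
  have : ProperSpace E := FiniteDimensional.proper ℝ E
  have hseq : ∀ n : ℕ, ∃ x ∈ S, (n : ℝ) + 1 ≤ ‖x - x₀‖ := fun n => by
    obtain ⟨x, hx, hn⟩ := hunb (n + 1 + ‖x₀‖)
    exact ⟨x, hx, by linarith [norm_sub_norm_le x x₀]⟩
  choose x hxS hxn using hseq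
  have hpos : ∀ n, 0 < ‖x n - x₀‖ := fun n => lt_of_lt_of_le (by positivity) (hxn n)
  obtain ⟨d, hd, φ, hφ, hlim⟩ := (isCompact_sphere (0 : E) 1).tendsto_subseq
    (x := fun n => ‖x n - x₀‖⁻¹ • (x n - x₀)) fun n => by
      rw [mem_sphere_zero_iff_norm, norm_smul, norm_inv, norm_norm, inv_mul_cancel₀ (hpos n).ne']
  refine ⟨d, ?_, fun t ht => ?_⟩
  · rintro rfl
    simp at hd
  · refine hcl.mem_of_tendsto ((hlim.const_smul t).const_add x₀) ?_
    obtain ⟨N, hN⟩ := exists_nat_ge t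
    filter_upwards [Filter.eventually_ge_atTop N] with n hn
    have hle : t ≤ ‖x (φ n) - x₀‖ := by
      have h1 : (N : ℝ) ≤ φ n := by exact_mod_cast hn.trans (hφ.id_le n)
      linarith [hxn (φ n)]
    have hmem := hcv.add_smul_sub_mem hx₀ (hxS (φ n))
      (t := t * ‖x (φ n) - x₀‖⁻¹)
      ⟨by positivity, by rw [← div_eq_mul_inv]; exact div_le_one_of_le₀ hle (norm_nonneg _)⟩
    simpa [mul_smul] using hmem

/-- A convex function on a real vector space dominated along a ray by `C - k ‖a + t w‖ ^ 2`
with `k > 0` forces `w = 0`. -/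
theorem eq_zero_of_convexOn_le_sub_norm_sq {E F : Type*} [AddCommGroup E] [Module ℝ E]
    [NormedAddCommGroup F] [InnerProductSpace ℝ F] {g : E → ℝ} (hg : ConvexOn ℝ Set.univ g)
    {x₀ d : E} {a w : F} {k C : ℝ} (hk : 0 < k)
    (hle : ∀ t : ℝ, 0 ≤ t → g (x₀ + t • d) ≤ C - k * ‖a + t • w‖ ^ 2) : w = 0 := by
  by_contra hw
  have hα : 0 < k * ‖w‖ ^ 2 := by have := norm_pos_iff.2 hw; positivity
  set α := k * ‖w‖ ^ 2 with hαd
  set β := C - k * ‖a‖ ^ 2 - g x₀ with hβ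
  set γ := -(k * (2 * ⟪a, w⟫)) - (g (x₀ + d) - g x₀) with hγ
  have key : ∀ t : ℝ, 1 ≤ t → α * t ^ 2 ≤ β + γ * t := by
    intro t ht
    have ht0 : 0 < t := by linarith
    have hc := hg.2 (Set.mem_univ x₀) (Set.mem_univ (x₀ + t • d))
      (sub_nonneg.2 (inv_le_one_of_one_le₀ ht)) (inv_nonneg.2 ht0.le) (sub_add_cancel 1 t⁻¹)
    have hpt : (1 - t⁻¹) • x₀ + t⁻¹ • (x₀ + t • d) = x₀ + d := by
      rw [smul_add, smul_smul, inv_mul_cancel₀ ht0.ne']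
      module
    rw [hpt, smul_eq_mul, smul_eq_mul] at hc
    have hc' : t * g (x₀ + d) ≤ (t - 1) * g x₀ + g (x₀ + t • d) := by
      have := mul_le_mul_of_nonneg_left hc ht0.le
      have e : t * ((1 - t⁻¹) * g x₀ + t⁻¹ * g (x₀ + t • d))
          = (t - 1) * g x₀ + g (x₀ + t • d) := by field_simp
      linarith
    have hn : ‖a + t • w‖ ^ 2 = ‖a‖ ^ 2 + 2 * (t * ⟪a, w⟫) + t ^ 2 * ‖w‖ ^ 2 := by
      rw [norm_add_sq_real, inner_smul_right, norm_smul, mul_pow, Real.norm_eq_abs, sq_abs]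
    have h := hle t ht0.le
    rw [hn] at h
    rw [hαd, hβ, hγ]
    linarith
  have hq : 0 ≤ (|β| + |γ|) / α := by positivity
  have h := key (1 + (|β| + |γ|) / α) (by linarith)
  set t := 1 + (|β| + |γ|) / α with ht
  have hαt : α * t = α + |β| + |γ| := by rw [ht]; field_simp; ring
  have h1 : α * t ^ 2 = t * (α + |β| + |γ|) := by rw [← hαt]; ring
  nlinarith [le_abs_self β, le_abs_self γ, abs_nonneg β, abs_nonneg γ]

/-- Points where an `EReal`-valued convex function lies below a concave real function
form a convex set. -/
theorem EConvex.convex_setOf_le {X Z : Type*} [AddCommGroup X] [Module ℝ X]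
    [AddCommGroup Z] [Module ℝ Z] {Ψ : Z → EReal} (hΨ : EConvex Ψ) (L : X →ₗ[ℝ] Z)
    {r : X → ℝ} (hr : ConcaveOn ℝ Set.univ r) :
    Convex ℝ {x | Ψ (L x) ≤ (r x : EReal)} := by
  intro x hx y hy a b ha hb hab
  simp only [Set.mem_ofPred_eq] at hx hy ⊢
  rw [map_add, map_smul, map_smul]
  calc Ψ (a • L x + b • L y) ≤ (a : EReal) * Ψ (L x) + (b : EReal) * Ψ (L y) :=
        hΨ _ _ a b ha hb hab
    _ ≤ (a : EReal) * (r x : EReal) + (b : EReal) * (r y : EReal) :=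
        add_le_add (mul_le_mul_of_nonneg_left hx (by exact_mod_cast ha))
          (mul_le_mul_of_nonneg_left hy (by exact_mod_cast hb))
    _ ≤ (r (a • x + b • y) : EReal) := by
        exact_mod_cast hr.2 (Set.mem_univ x) (Set.mem_univ y) ha hb hab

theorem LowerSemicontinuous.isClosed_setOf_comp_le {X Z : Type*} [TopologicalSpace X]
    [TopologicalSpace Z] {Ψ : Z → EReal} (hΨ : LowerSemicontinuous Ψ) {L : X → Z}
    (hL : Continuous L) {r : X → ℝ} (hr : Continuous r) :
    IsClosed {x | Ψ (L x) ≤ (r x : EReal)} :=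
  hΨ.isClosed_epigraph.preimage (hL.prodMk (continuous_coe_real_ereal.comp hr))

/-- Testing the infimum in the generalized Moreau enhancement at a single point `v`. -/
theorem le_of_Jcost_lt {X Y Z Z' : Type*}
    [NormedAddCommGroup X] [InnerProductSpace ℝ X]
    [NormedAddCommGroup Y] [InnerProductSpace ℝ Y]
    [NormedAddCommGroup Z] [InnerProductSpace ℝ Z]
    [NormedAddCommGroup Z'] [InnerProductSpace ℝ Z']
    {A : X →ₗ[ℝ] Y} {Lm : X →ₗ[ℝ] Z} {B : Z →ₗ[ℝ] Z'} {f : Y → ℝ} {Ψ : Z → EReal}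
    (hΨbot : ∀ z : Z, Ψ z ≠ ⊥) {μ : ℝ} (hμ : 0 < μ) {x : X} {C : ℝ}
    (hx : Jcost A Lm B f Ψ μ x < C) {v : Z} {p : ℝ} (hp : Ψ v = p) :
    Ψ (Lm x) ≤ (((C - f (A x)) / μ + p + 1 / 2 * ‖B (Lm x - v)‖ ^ 2 : ℝ) : EReal) := by
  set q : ℝ := p + 1 / 2 * ‖B (Lm x - v)‖ ^ 2 with hq
  have hinf : (⨅ v : Z, (Ψ v + ((((1 : ℝ) / 2) * ‖B (Lm x - v)‖ ^ 2 : ℝ) : EReal))) ≤ (q : EReal) :=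
    (iInf_le _ v).trans (by rw [hp, hq, EReal.coe_add])
  have hle : ((f (A x) : ℝ) : EReal) + (μ : EReal) * (Ψ (Lm x) - (q : EReal)) < (C : EReal) :=
    lt_of_le_of_lt (add_le_add_right (mul_le_mul_of_nonneg_left
      (EReal.sub_le_sub le_rfl hinf) (by exact_mod_cast hμ.le)) _) hx
  cases hs : Ψ (Lm x) with
  | bot => exact absurd hs (hΨbot _)
  | top =>
    rw [hs, EReal.top_sub_coe, EReal.coe_mul_top_of_pos hμ, EReal.coe_add_top] at hle
    exact absurd hle not_top_lt
  | coe s =>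
    rw [hs] at hle
    have h : f (A x) + μ * (s - q) < C := by exact_mod_cast hle
    have h' : s - q ≤ (C - f (A x)) / μ := by
      rw [le_div_iff₀ hμ]
      linarith
    rw [EReal.coe_le_coe_iff]
    linarith

/-- The majorant of `Ψ ∘ 𝔏` on a sublevel set of the cost is concave under the overall
convexity condition. -/
theorem concaveOn_majorant {X Y Z Z' : Type*}
    [NormedAddCommGroup X] [InnerProductSpace ℝ X]
    [NormedAddCommGroup Y] [InnerProductSpace ℝ Y]
    [NormedAddCommGroup Z] [InnerProductSpace ℝ Z]
    [NormedAddCommGroup Z'] [InnerProductSpace ℝ Z']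
    {A : X →ₗ[ℝ] Y} {Lm : X →ₗ[ℝ] Z} {B : Z →ₗ[ℝ] Z'} {f : Y → ℝ} {μ : ℝ} (hμ : 0 < μ)
    (hC1 : ConvexOn ℝ Set.univ (fun x : X => f (A x) - μ / 2 * ‖B (Lm x)‖ ^ 2))
    (C p : ℝ) (v : Z) :
    ConcaveOn ℝ Set.univ
      (fun x => (C - f (A x)) / μ + p + 1 / 2 * ‖B (Lm x - v)‖ ^ 2) := by
  have hexp : ∀ x, (C - f (A x)) / μ + p + 1 / 2 * ‖B (Lm x - v)‖ ^ 2
      = -(μ⁻¹ * (f (A x) - μ / 2 * ‖B (Lm x)‖ ^ 2)) - ⟪B v, B (Lm x)⟫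
        + (C / μ + p + 1 / 2 * ‖B v‖ ^ 2) := fun x => by
    rw [map_sub, norm_sub_sq_real, real_inner_comm]
    field_simp
    ring
  refine ⟨convex_univ, fun x hx y hy a b ha hb hab => ?_⟩
  have h := mul_le_mul_of_nonneg_left (hC1.2 hx hy ha hb hab) (inv_nonneg.2 hμ.le)
  simp only [smul_eq_mul] at h ⊢
  rw [hexp, hexp, hexp]
  have hin : ⟪B v, B (Lm (a • x + b • y))⟫
      = a * ⟪B v, B (Lm x)⟫ + b * ⟪B v, B (Lm y)⟫ := by
    simp [inner_add_right, inner_smul_right]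
  rw [hin]
  obtain rfl : b = 1 - a := by linarith
  linarith

theorem stmt11
    {X Y Z Z' W : Type*}
    [NormedAddCommGroup X] [InnerProductSpace ℝ X] [FiniteDimensional ℝ X]
    [NormedAddCommGroup Y] [InnerProductSpace ℝ Y] [FiniteDimensional ℝ Y]
    [NormedAddCommGroup Z] [InnerProductSpace ℝ Z] [FiniteDimensional ℝ Z]
    [NormedAddCommGroup Z'] [InnerProductSpace ℝ Z'] [FiniteDimensional ℝ Z']
    [NormedAddCommGroup W] [InnerProductSpace ℝ W] [FiniteDimensional ℝ W]
    (A : X →ₗ[ℝ] Y) (Lm : X →ₗ[ℝ] Z) (B : Z →ₗ[ℝ] Z') (Cm : X →ₗ[ℝ] W)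
    (f : Y → ℝ) (hf : ConvexOn ℝ Set.univ f)
    (Ψ : Z → EReal) (hΨbot : ∀ z : Z, Ψ z ≠ ⊥) (hΨlsc : LowerSemicontinuous Ψ)
    (hΨconv : EConvex Ψ) (hΨcoer : ECoercive Ψ)
    (μ : ℝ) (hμ : 0 < μ)
    (Δ : Set W) (hΔne : Δ.Nonempty) (hΔcl : IsClosed Δ) (hΔcv : Convex ℝ Δ)
    (hfeas : ∃ x : X, Ψ (Lm x) ≠ ⊤ ∧ Cm x ∈ Δ)
    (hC1 : ConvexOn ℝ Set.univ (fun x : X => f (A x) - μ / 2 * ‖B (Lm x)‖ ^ 2))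
    (hcase : (RCoercive f ∧ LinearMap.ker A ⊓ LinearMap.ker Lm = ⊥) ∨
      ((∃ c : ℝ, ∀ y : Y, c ≤ f y) ∧ LinearMap.ker Lm = ⊥)) :
    ECoercive (Jcost A Lm B f Ψ μ) := by
  intro C
  by_contra! hnot
  let r : Z → ℝ → X → ℝ := fun v p x =>
    (C - f (A x)) / μ + p + 1 / 2 * ‖B (Lm x - v)‖ ^ 2
  let S : Set X := ⋂ (v : Z) (p : ℝ) (_ : Ψ v = p), {x | Ψ (Lm x) ≤ (r v p x : EReal)}
  have hmem : ∀ x, x ∈ S ↔ ∀ (v : Z) (p : ℝ), Ψ v = p → Ψ (Lm x) ≤ (r v p x : EReal) :=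
    fun x => by simp [S]
  have hA : Continuous A := A.continuous_of_finiteDimensional
  have hL : Continuous Lm := Lm.continuous_of_finiteDimensional
  have hB : Continuous B := B.continuous_of_finiteDimensional
  have hfc : Continuous f := continuousOn_univ.1 (hf.continuousOn isOpen_univ)
  have hScl : IsClosed S := isClosed_iInter fun v => isClosed_iInter fun p =>
    isClosed_iInter fun _ => hΨlsc.isClosed_setOf_comp_le hL (by fun_prop)
  have hScv : Convex ℝ S := convex_iInter fun v => convex_iInter fun p => convex_iInter fun _ =>
    hΨconv.convex_setOf_le Lm (concaveOn_majorant hμ hC1 C p v)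
  have hunb : ∀ R : ℝ, ∃ x ∈ S, R ≤ ‖x‖ := fun R => by
    obtain ⟨x, hR, hx⟩ := hnot R
    exact ⟨x, (hmem x).2 fun v p hp => le_of_Jcost_lt hΨbot hμ hx hp, hR⟩
  have hfin : ∀ x ∈ S, ∃ s : ℝ, Ψ (Lm x) = s := fun x hx => by
    obtain ⟨x', hx', -⟩ := hfeas
    have h := (hmem x).1 hx (Lm x') _ (EReal.coe_toReal hx' (hΨbot _)).symm
    exact ⟨_, (EReal.coe_toReal (ne_top_of_le_ne_top (EReal.coe_ne_top _) h) (hΨbot _)).symm⟩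
  have hfle : ∀ x ∈ S, f (A x) ≤ C := fun x hx => by
    obtain ⟨s, hs⟩ := hfin x hx
    have h := (hmem x).1 hx (Lm x) s hs
    rw [hs, EReal.coe_le_coe_iff] at h
    simp only [r, sub_self, map_zero, norm_zero] at h
    have h' : 0 ≤ (C - f (A x)) / μ := by linarith
    rw [le_div_iff₀ hμ, zero_mul] at h'
    linarith
  obtain ⟨x₀, hx₀, -⟩ := hunb 0
  obtain ⟨d, hd, hray⟩ := exists_ray_of_unbounded hScl hScv hunb hx₀
  obtain ⟨hLd, c, hc⟩ : Lm d ≠ 0 ∧ ∃ c : ℝ, ∀ t : ℝ, c ≤ f (A (x₀ + t • d)) := by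
    rcases hcase with ⟨hfco, hker⟩ | ⟨⟨c, hc⟩, hker⟩
    · have hAd : A d = 0 := by
        by_contra hAd
        obtain ⟨R, hR⟩ := hfco (C + 1)
        obtain ⟨t, ht, htR⟩ := exists_le_norm_add_smul (A x₀) hAd R
        have h1 := hR _ htR
        have h2 := hfle _ (hray t ht)
        rw [map_add, map_smul] at h2
        linarith
      refine ⟨fun hLd => hd ?_, f (A x₀), fun t => by simp [hAd]⟩
      have : d ∈ LinearMap.ker A ⊓ LinearMap.ker Lm := ⟨hAd, hLd⟩
      rwa [hker, Submodule.mem_bot] at this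
    · exact ⟨fun hLd => hd (LinearMap.ker_eq_bot'.1 hker d hLd), c, fun t => hc _⟩
  have hBLd : B (Lm d) = 0 :=
    eq_zero_of_convexOn_le_sub_norm_sq (a := B (Lm x₀)) (C := C) hC1 (half_pos hμ)
      fun t ht => by
        have := hfle _ (hray t ht)
        simp only [map_add, map_smul] at this ⊢
        linarith
  obtain ⟨p, hp⟩ := hfin x₀ hx₀
  obtain ⟨R, hR⟩ := hΨcoer ((C - c) / μ + p + 1)
  obtain ⟨t, ht, htR⟩ := exists_le_norm_add_smul (Lm x₀) hLd R
  have h := (hR _ htR).trans (by simpa using (hmem _).1 (hray t ht) (Lm x₀) p hp)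
  have h' : (C - c) / μ + p + 1 ≤ r (Lm x₀) p (x₀ + t • d) := by
    rw [← EReal.coe_le_coe_iff]
    simpa using h
  have hle : (C - f (A (x₀ + t • d))) / μ ≤ (C - c) / μ := by
    have := hc t
    gcongr
  have hr : r (Lm x₀) p (x₀ + t • d) = (C - f (A (x₀ + t • d))) / μ + p := by
    simp [r, hBLd]
  linarith
end
end

section
/- In the GME model setting, assume condition (C1) (𝔡(x) := f(Ax) − (μ/2)‖B𝔏x‖² is convex on X), that f is coercive, and that the constraint set ℭ⁻¹(Δ) = {x ∈ X : ℭx ∈ Δ} is asymptotically multipolyhedral, i.e. ℭ⁻¹(Δ) = S + K for some compact set S ⊂ X and some polyhedral cone K ⊂ X (a cone that is a finite intersection of closed half-spaces). Then the constrained problem has a minimizer: there exists x* ∈ X with ℭx* ∈ Δ such that J(x*) ≤ J(x) for every x ∈ X with ℭx ∈ Δ. -/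
open scoped Pointwise RealInnerProductSpace

noncomputable section

/-- Points of a polyhedron whose image under a linear map is bounded can be replaced by
uniformly bounded points of the polyhedron with the same image. -/
theorem exists_bounded_lift_of_polyhedron {X V : Type*}
    [NormedAddCommGroup X] [InnerProductSpace ℝ X] [FiniteDimensional ℝ X]
    [NormedAddCommGroup V] [NormedSpace ℝ V]
    (T : X →L[ℝ] V) {n : ℕ} (u : Fin n → X) (c : Fin n → ℝ) (R : ℝ) :
    ∃ R' : ℝ, ∀ x, (∀ i, ⟪u i, x⟫ ≤ c i) → ‖T x‖ ≤ R →
      ∃ y, (∀ i, ⟪u i, y⟫ ≤ c i) ∧ T y = T x ∧ ‖y‖ ≤ R' := by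
  by_contra! hcon
  have hmin : ∀ k : ℕ, ∃ x, (∀ i, ⟪u i, x⟫ ≤ c i) ∧ ‖T x‖ ≤ R ∧ (k : ℝ) < ‖x‖ ∧
      ∀ y, (∀ i, ⟪u i, y⟫ ≤ c i) → T y = T x → ‖x‖ ≤ ‖y‖ := by
    intro k
    obtain ⟨x₀, hx₀, hTx₀, hlt⟩ := hcon k
    have hclosed : IsClosed {y : X | (∀ i, ⟪u i, y⟫ ≤ c i) ∧ T y = T x₀} := by
      simp only [Set.ofPred_and, Set.ofPred_forall]
      exact (isClosed_iInter fun i => isClosed_le (by fun_prop) continuous_const).inter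
        (isClosed_eq T.continuous continuous_const)
    obtain ⟨x, ⟨hx, hTx⟩, hdist⟩ := hclosed.exists_infDist_eq_dist ⟨x₀, hx₀, rfl⟩ 0
    refine ⟨x, hx, hTx ▸ hTx₀, hlt x hx hTx, fun y hy hTy => ?_⟩
    have := Metric.infDist_le_dist_of_mem (x := (0 : X))
      (show y ∈ {y : X | (∀ i, ⟪u i, y⟫ ≤ c i) ∧ T y = T x₀} from ⟨hy, hTy.trans hTx⟩)
    simpa [hdist, dist_zero_left] using this
  choose x hx hTx hnorm hmin using hmin
  have hpos : ∀ k, 0 < ‖x k‖ := fun k => (Nat.cast_nonneg k).trans_lt (hnorm k)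
  have htop : Filter.Tendsto (fun k => ‖x k‖) Filter.atTop Filter.atTop :=
    Filter.tendsto_atTop_mono (fun k => (hnorm k).le) tendsto_natCast_atTop_atTop
  obtain ⟨d, hd, φ, hφ, hlim⟩ := (isCompact_sphere (0 : X) 1).tendsto_subseq
    (x := fun k => (‖x k‖)⁻¹ • x k) (fun k => by
      simp [norm_smul, inv_mul_cancel₀ (hpos k).ne'])
  have hdn : ‖d‖ = 1 := by simpa using hd
  have htopφ := htop.comp hφ.tendsto_atTop
  have hinv : Filter.Tendsto (fun k => (‖x (φ k)‖)⁻¹) Filter.atTop (nhds 0) :=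
    tendsto_inv_atTop_zero.comp htopφ
  have hTd : T d = 0 := by
    refine tendsto_nhds_unique ((T.continuous.tendsto d).comp hlim) ?_
    refine squeeze_zero_norm (a := fun k => (‖x (φ k)‖)⁻¹ * R) (fun k => ?_)
      (by simpa using hinv.mul_const R)
    simp only [Function.comp_apply, map_smul, norm_smul, norm_inv, norm_norm]
    exact mul_le_mul_of_nonneg_left (hTx _) (by positivity)
  have hinner : ∀ v : X, Filter.Tendsto (fun k => (‖x (φ k)‖)⁻¹ * ⟪v, x (φ k)⟫)
      Filter.atTop (nhds ⟪v, d⟫) := by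
    intro v
    have := (tendsto_const_nhds (x := v)).inner hlim (𝕜 := ℝ)
    simpa [real_inner_smul_right] using this
  have hcancel : ∀ (v : X) k, ‖x (φ k)‖ * ((‖x (φ k)‖)⁻¹ * ⟪v, x (φ k)⟫) = ⟪v, x (φ k)⟫ :=
    fun v k => mul_inv_cancel_left₀ (hpos _).ne' _
  have hud : ∀ i, ⟪u i, d⟫ ≤ 0 := by
    intro i
    refine le_of_tendsto_of_tendsto' (hinner (u i)) (by simpa using hinv.mul_const (c i)) ?_
    exact fun k => mul_le_mul_of_nonneg_left (hx _ i) (by positivity)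
  have hfeas : ∀ᶠ k in Filter.atTop, ∀ i, ⟪u i, x (φ k) - d⟫ ≤ c i := by
    refine Filter.eventually_all.2 fun i => ?_
    simp only [inner_sub_right]
    rcases (hud i).eq_or_lt with h | h
    · exact Filter.Eventually.of_forall fun k => by simpa [h] using hx (φ k) i
    · have hbot := htopφ.atTop_mul_neg h (hinner (u i))
      filter_upwards [hbot.eventually_le_atBot (c i + ⟪u i, d⟫)] with k hk
      have := hcancel (u i) k
      simp only [Function.comp_apply] at hk
      linarith
  have hdx : ∀ᶠ k in Filter.atTop, 1 ≤ ⟪d, x (φ k)⟫ := by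
    have htop' := htopφ.atTop_mul_pos (C := ⟪d, d⟫) (by simp [hdn]) (hinner d)
    filter_upwards [htop'.eventually_ge_atTop 1] with k hk
    simpa only [Function.comp_apply, hcancel] using hk
  obtain ⟨k, hk, hk'⟩ := (hfeas.and hdx).exists
  have hle := hmin (φ k) (x (φ k) - d) hk (by simp [hTd])
  have hsq := norm_sub_sq_real (x (φ k)) d
  rw [real_inner_comm, hdn] at hsq
  have := pow_le_pow_left₀ (norm_nonneg _) hle 2
  linarith

/-- A lower semicontinuous function that is invariant along the fibres of a linear map, and whose
sublevel set at some point has bounded image, attains its minimum over any closed set that is the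
sum of a compact set and a polyhedron. -/
theorem exists_forall_le_of_add_polyhedron {X V : Type*}
    [NormedAddCommGroup X] [InnerProductSpace ℝ X] [FiniteDimensional ℝ X]
    [NormedAddCommGroup V] [NormedSpace ℝ V]
    (T : X →L[ℝ] V) {J : X → EReal} (hJ : LowerSemicontinuous J)
    (hJT : ∀ x y, T x = T y → J x = J y)
    {F S K : Set X} (hF : IsClosed F) (hFSK : F = S + K) (hS : IsCompact S)
    (hK : ∃ (n : ℕ) (u : Fin n → X) (c : Fin n → ℝ), K = ⋂ i, {x : X | ⟪u i, x⟫ ≤ c i})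
    {x₀ : X} (hx₀ : x₀ ∈ F) {R : ℝ} (hR : ∀ x, J x < J x₀ → ‖T x‖ ≤ R) :
    ∃ y ∈ F, ∀ x ∈ F, J y ≤ J x := by
  obtain ⟨n, u, c, hK⟩ := hK
  have hmemK : ∀ x, x ∈ K ↔ ∀ i, ⟪u i, x⟫ ≤ c i := fun x => by simp [hK]
  obtain ⟨s₀, hs₀⟩ := hS.isBounded.exists_norm_le
  obtain ⟨R', hR'⟩ := exists_bounded_lift_of_polyhedron T u c (R + ‖T‖ * s₀)
  have hcompact : IsCompact (F ∩ Metric.closedBall 0 (max ‖x₀‖ (s₀ + R'))) :=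
    (isCompact_closedBall _ _).inter_left hF
  have hx₀' : x₀ ∈ F ∩ Metric.closedBall 0 (max ‖x₀‖ (s₀ + R')) := ⟨hx₀, by simp⟩
  obtain ⟨y, hy, hymin⟩ := (hJ.lowerSemicontinuousOn _).exists_isMinOn ⟨x₀, hx₀'⟩ hcompact
  refine ⟨y, hy.1, fun x hx => ?_⟩
  rcases le_or_gt (J x₀) (J x) with h | h
  · exact (hymin hx₀').trans h
  · obtain ⟨s, hs, k, hk, rfl⟩ := Set.mem_add.1 (hFSK ▸ hx)
    obtain ⟨k', hk', hTk', hnk'⟩ := hR' k ((hmemK k).1 hk) (by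
      calc ‖T k‖ = ‖T (s + k) - T s‖ := by simp
        _ ≤ ‖T (s + k)‖ + ‖T s‖ := norm_sub_le _ _
        _ ≤ R + ‖T‖ * s₀ := add_le_add (hR _ h) (T.le_opNorm_of_le (hs₀ s hs)))
    rw [hJT (s + k) (s + k') (by simp [hTk'])]
    refine hymin ⟨hFSK ▸ Set.add_mem_add hs ((hmemK k').2 hk'), ?_⟩
    rw [mem_closedBall_zero_iff]
    exact ((norm_add_le _ _).trans (add_le_add (hs₀ s hs) hnk')).trans (le_max_right _ _)

/-- A lower semicontinuous coercive function that avoids `⊥` is bounded below by a real. -/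
theorem ECoercive.exists_le {Z : Type*} [NormedAddCommGroup Z] [NormedSpace ℝ Z]
    [FiniteDimensional ℝ Z] {Ψ : Z → EReal} (hcoer : ECoercive Ψ) (hbot : ∀ z, Ψ z ≠ ⊥)
    (hlsc : LowerSemicontinuous Ψ) : ∃ m : ℝ, ∀ z, (m : EReal) ≤ Ψ z := by
  have : ProperSpace Z := FiniteDimensional.proper ℝ Z
  obtain ⟨R, hR⟩ := hcoer 0
  obtain ⟨z₀, -, hz₀⟩ := (hlsc.lowerSemicontinuousOn _).exists_isMinOn
    (Metric.nonempty_closedBall.2 (le_max_right R 0))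
    (isCompact_closedBall (0 : Z) (max R 0))
  obtain ⟨m, hm⟩ : ∃ m : ℝ, (m : EReal) ≤ Ψ z₀ := by
    rcases eq_or_ne (Ψ z₀) ⊤ with h | h
    · exact ⟨0, h ▸ le_top⟩
    · exact ⟨(Ψ z₀).toReal, (EReal.coe_toReal h (hbot z₀)).le⟩
  refine ⟨min m 0, fun z => ?_⟩
  rcases le_or_gt ‖z‖ (max R 0) with h | h
  · exact (EReal.coe_le_coe_iff.2 (min_le_left m 0)).trans
      (hm.trans (hz₀ (mem_closedBall_zero_iff.2 h)))
  · exact (EReal.coe_le_coe_iff.2 (min_le_right m 0)).trans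
      (hR z ((le_max_left R 0).trans h.le))

/-- The infimum subtracted in the generalized Moreau enhanced function is a real-valued function
dominated by `Ψ` and by a quadratic in `B z`. -/
theorem exists_moreau_eq_coe {Z Z' : Type*} [NormedAddCommGroup Z] [InnerProductSpace ℝ Z]
    [NormedAddCommGroup Z'] [InnerProductSpace ℝ Z'] {Ψ : Z → EReal} (B : Z →ₗ[ℝ] Z')
    {m : ℝ} (hm : ∀ z, (m : EReal) ≤ Ψ z) {v₀ : Z} {p : ℝ} (hp : Ψ v₀ = p) :
    ∃ e : Z → ℝ, (∀ z, (e z : EReal) =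
        ⨅ v : Z, (Ψ v + ((((1 : ℝ) / 2) * ‖B (z - v)‖ ^ 2 : ℝ) : EReal))) ∧
      (∀ z, (e z : EReal) ≤ Ψ z) ∧
      (∀ z, e z ≤ p + 1 / 2 * (‖B z‖ + ‖B v₀‖) ^ 2) := by
  have hlow : ∀ z, (m : EReal) ≤
      ⨅ v : Z, (Ψ v + ((((1 : ℝ) / 2) * ‖B (z - v)‖ ^ 2 : ℝ) : EReal)) := by
    refine fun z => le_iInf fun v => ?_
    have := add_le_add (hm v) (EReal.coe_nonneg.2
      (show 0 ≤ (1 : ℝ) / 2 * ‖B (z - v)‖ ^ 2 by positivity))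
    simpa using this
  have hup : ∀ z, (⨅ v : Z, (Ψ v + ((((1 : ℝ) / 2) * ‖B (z - v)‖ ^ 2 : ℝ) : EReal))) ≤
      ((p + 1 / 2 * (‖B z‖ + ‖B v₀‖) ^ 2 : ℝ) : EReal) := by
    refine fun z => (iInf_le _ v₀).trans ?_
    rw [hp, ← EReal.coe_add, EReal.coe_le_coe_iff, map_sub]
    gcongr
    exact norm_sub_le _ _
  have hcoe : ∀ z, ∃ r : ℝ, (r : EReal) =
      ⨅ v : Z, (Ψ v + ((((1 : ℝ) / 2) * ‖B (z - v)‖ ^ 2 : ℝ) : EReal)) := fun z =>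
    ⟨_, EReal.coe_toReal ((hup z).trans_lt (EReal.coe_lt_top _)).ne
      ((EReal.bot_lt_coe _).trans_le (hlow z)).ne'⟩
  choose e he using hcoe
  refine ⟨e, he, fun z => ?_, fun z => ?_⟩
  · rw [he]
    exact (iInf_le _ z).trans (by simp)
  · rw [← EReal.coe_le_coe_iff, he]
    exact hup z

/-- The generalized Moreau enhanced function is lower semicontinuous. -/
theorem lowerSemicontinuous_GME {Z Z' : Type*} [NormedAddCommGroup Z] [InnerProductSpace ℝ Z]
    [FiniteDimensional ℝ Z] [NormedAddCommGroup Z'] [InnerProductSpace ℝ Z'] {Ψ : Z → EReal}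
    (B : Z →ₗ[ℝ] Z') (hlsc : LowerSemicontinuous Ψ) (hbot : ∀ z, Ψ z ≠ ⊥) {e : Z → ℝ}
    (he : ∀ z, (e z : EReal) =
      ⨅ v : Z, (Ψ v + ((((1 : ℝ) / 2) * ‖B (z - v)‖ ^ 2 : ℝ) : EReal))) :
    LowerSemicontinuous (GME Ψ B) := by
  have hBc : Continuous B := B.continuous_of_finiteDimensional
  have husc : UpperSemicontinuous fun z => (e z : EReal) := by
    simp only [he]
    refine upperSemicontinuous_iInf fun v => Continuous.upperSemicontinuous ?_
    refine continuous_iff_continuousAt.2 fun z => ?_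
    have hq : ContinuousAt
        (fun z => ((((1 : ℝ) / 2) * ‖B (z - v)‖ ^ 2 : ℝ) : EReal)) z :=
      (continuous_coe_real_ereal.comp (by fun_prop)).continuousAt
    exact ContinuousAt.comp (f := fun z => (Ψ v, ((1 / 2 * ‖B (z - v)‖ ^ 2 : ℝ) : EReal)))
      (EReal.continuousAt_add (Or.inr (EReal.coe_ne_bot _)) (Or.inr (EReal.coe_ne_top _)))
      (continuousAt_const.prodMk hq)
  have hneg : LowerSemicontinuous fun z => -(e z : EReal) :=
    continuous_neg.comp_upperSemicontinuous_antitone husc fun _ _ h => EReal.neg_le_neg_iff.2 h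
  have hsum := hlsc.add' hneg fun z =>
    EReal.continuousAt_add (Or.inr (by simp)) (Or.inl (hbot z))
  have hG : GME Ψ B = fun z => Ψ z + -(e z : EReal) := by
    funext z
    rw [GME, ← he, sub_eq_add_neg]
  exact hG ▸ hsum

/-- A linear map vanishing on the kernel of another one is controlled by it. -/
theorem LinearMap.exists_norm_le_mul_norm_of_ker_le_ker {X Y Z : Type*}
    [NormedAddCommGroup X] [NormedSpace ℝ X]
    [NormedAddCommGroup Y] [NormedSpace ℝ Y] [FiniteDimensional ℝ Y]
    [NormedAddCommGroup Z] [NormedSpace ℝ Z]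
    (A : X →ₗ[ℝ] Y) (P : X →ₗ[ℝ] Z) (h : LinearMap.ker A ≤ LinearMap.ker P) :
    ∃ C, 0 ≤ C ∧ ∀ x, ‖P x‖ ≤ C * ‖A x‖ := by
  obtain ⟨g, hg⟩ := A.rangeRestrict.exists_rightInverse_of_surjective A.range_rangeRestrict
  refine ⟨_, norm_nonneg (LinearMap.toContinuousLinearMap (P ∘ₗ g)), fun x => ?_⟩
  have hker : x - g (A.rangeRestrict x) ∈ LinearMap.ker A := by
    have := congrArg Subtype.val (LinearMap.congr_fun hg (A.rangeRestrict x))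
    rw [LinearMap.mem_ker, map_sub, sub_eq_zero]
    exact this.symm
  have hP : P x = P (g (A.rangeRestrict x)) := by
    simpa [sub_eq_zero] using h hker
  rw [hP]
  exact (LinearMap.toContinuousLinearMap (P ∘ₗ g)).le_opNorm (A.rangeRestrict x)

theorem stmt13
    {X Y Z Z' W : Type*}
    [NormedAddCommGroup X] [InnerProductSpace ℝ X] [FiniteDimensional ℝ X]
    [NormedAddCommGroup Y] [InnerProductSpace ℝ Y] [FiniteDimensional ℝ Y]
    [NormedAddCommGroup Z] [InnerProductSpace ℝ Z] [FiniteDimensional ℝ Z]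
    [NormedAddCommGroup Z'] [InnerProductSpace ℝ Z'] [FiniteDimensional ℝ Z']
    [NormedAddCommGroup W] [InnerProductSpace ℝ W] [FiniteDimensional ℝ W]
    (A : X →ₗ[ℝ] Y) (Lm : X →ₗ[ℝ] Z) (B : Z →ₗ[ℝ] Z') (Cm : X →ₗ[ℝ] W)
    (f : Y → ℝ) (hf : ConvexOn ℝ Set.univ f)
    (Ψ : Z → EReal) (hΨbot : ∀ z : Z, Ψ z ≠ ⊥) (hΨlsc : LowerSemicontinuous Ψ)
    (hΨconv : EConvex Ψ) (hΨcoer : ECoercive Ψ)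
    (μ : ℝ) (hμ : 0 < μ)
    (Δ : Set W) (hΔne : Δ.Nonempty) (hΔcl : IsClosed Δ) (hΔcv : Convex ℝ Δ)
    (hfeas : ∃ x : X, Ψ (Lm x) ≠ ⊤ ∧ Cm x ∈ Δ)
    (hC1 : ConvexOn ℝ Set.univ (fun x : X => f (A x) - μ / 2 * ‖B (Lm x)‖ ^ 2))
    (hfcoer : RCoercive f) (S K : Set X) (hS : IsCompact S)
    (hKcone : ∀ x ∈ K, ∀ a : ℝ, 0 < a → a • x ∈ K)
    (hKpoly : ∃ (n : ℕ) (u : Fin n → X) (c : Fin n → ℝ),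
      K = ⋂ i, {x : X | ⟪u i, x⟫ ≤ c i})
    (hdecomp : {x : X | Cm x ∈ Δ} = S + K) :
    ∃ xs : X, Cm xs ∈ Δ ∧
      ∀ x : X, Cm x ∈ Δ → Jcost A Lm B f Ψ μ xs ≤ Jcost A Lm B f Ψ μ x := by
  obtain ⟨x₀, hx₀, hx₀F⟩ := hfeas
  obtain ⟨m, hm⟩ := hΨcoer.exists_le hΨbot hΨlsc
  have hp := (EReal.coe_toReal hx₀ (hΨbot _)).symm
  set p := (Ψ (Lm x₀)).toReal
  obtain ⟨e, he, heΨ, hele⟩ := exists_moreau_eq_coe B hm hp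
  have hJe : ∀ x, Jcost A Lm B f Ψ μ x = (f (A x) : EReal) + μ * (Ψ (Lm x) - e (Lm x)) :=
    fun x => by rw [Jcost, GME, he]
  have hAc : Continuous A := A.continuous_of_finiteDimensional
  have hLc : Continuous Lm := Lm.continuous_of_finiteDimensional
  have hCc : Continuous Cm := Cm.continuous_of_finiteDimensional
  have hfc : Continuous f := by
    have := hf.continuousOn isOpen_univ
    rwa [← continuousOn_univ]
  have hlsc : LowerSemicontinuous (Jcost A Lm B f Ψ μ) := by
    have hG : LowerSemicontinuous fun x => (μ : EReal) * GME Ψ B (Lm x) := by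
      refine Continuous.comp_lowerSemicontinuous (g := fun t => (μ : EReal) * t) ?_
        ((lowerSemicontinuous_GME B hΨlsc hΨbot he).comp hLc)
        fun a b h => mul_le_mul_of_nonneg_left h (EReal.coe_nonneg.2 hμ.le)
      refine continuous_iff_continuousAt.2 fun t => ?_
      have hμ' : (μ : EReal) ≠ 0 := EReal.coe_ne_zero.2 hμ.ne'
      exact ContinuousAt.comp (f := fun t => ((μ : EReal), t))
        (EReal.continuousAt_mul (Or.inl hμ') (Or.inl hμ') (Or.inl (EReal.coe_ne_bot _))
          (Or.inl (EReal.coe_ne_top _))) (by fun_prop)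
    have hfA : Continuous fun x => (f (A x) : EReal) :=
      continuous_coe_real_ereal.comp (hfc.comp hAc)
    exact hfA.lowerSemicontinuous.add' hG fun x =>
      EReal.continuousAt_add (Or.inl (EReal.coe_ne_top _)) (Or.inl (EReal.coe_ne_bot _))
  have hker : LinearMap.ker A ≤ LinearMap.ker (B ∘ₗ Lm) := by
    intro d hd
    rw [LinearMap.mem_ker] at hd ⊢
    have h := hC1.2 (Set.mem_univ d) (Set.mem_univ (-d))
      (show (0 : ℝ) ≤ 1 / 2 by norm_num) (show (0 : ℝ) ≤ 1 / 2 by norm_num) (by norm_num)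
    simp only [smul_neg, add_neg_cancel, map_zero, map_neg, hd, norm_neg, norm_zero, neg_zero,
      smul_eq_mul] at h
    have : ‖B (Lm d)‖ ^ 2 ≤ 0 := by
      by_contra! hpos
      nlinarith [mul_pos hμ hpos]
    exact norm_eq_zero.1 (pow_eq_zero_iff two_ne_zero |>.1 (le_antisymm this (sq_nonneg _)))
  obtain ⟨C, hC0, hC⟩ := LinearMap.exists_norm_le_mul_norm_of_ker_le_ker A (B ∘ₗ Lm) hker
  simp only [LinearMap.comp_apply] at hC
  set j := f (A x₀) + μ * (p - e (Lm x₀)) with hj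
  have hJ₀ : Jcost A Lm B f Ψ μ x₀ = j := by
    rw [hJe, hp, hj]
    norm_cast
  obtain ⟨R₁, hR₁⟩ := hfcoer (j + 1)
  obtain ⟨y₀, -, hy₀⟩ := (isCompact_closedBall (0 : Y) (max R₁ 0)).exists_isMinOn
    (Metric.nonempty_closedBall.2 (le_max_right R₁ 0)) hfc.continuousOn
  obtain ⟨R₂, hR₂⟩ := hΨcoer
    (p + 1 / 2 * (C * R₁ + ‖B (Lm x₀)‖) ^ 2 + (j - f y₀) / μ + 1)
  refine exists_forall_le_of_add_polyhedron
    (LinearMap.toContinuousLinearMap (A.prod Lm)) hlsc (fun x y hxy => ?_)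
    (hΔcl.preimage hCc) hdecomp hS hKpoly hx₀F (R := max R₁ R₂) (fun x hx => ?_)
  · have hxy' : (A x, Lm x) = (A y, Lm y) := hxy
    rw [Prod.mk.injEq] at hxy'
    rw [Jcost, Jcost, hxy'.1, hxy'.2]
  · rw [hJ₀, hJe] at hx
    have hfin : Ψ (Lm x) ≠ ⊤ := by
      intro htop
      rw [htop, EReal.top_sub_coe, EReal.coe_mul_top_of_pos hμ, EReal.coe_add_top] at hx
      exact not_top_lt hx
    have hq := (EReal.coe_toReal hfin (hΨbot _)).symm
    set q := (Ψ (Lm x)).toReal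
    have heq : e (Lm x) ≤ q := by
      have := heΨ (Lm x)
      rwa [hq, EReal.coe_le_coe_iff] at this
    have hlt : f (A x) + μ * (q - e (Lm x)) < j := by
      rw [hq] at hx
      exact_mod_cast hx
    have hA : ‖A x‖ ≤ R₁ := by
      by_contra! h
      have := hR₁ (A x) h.le
      nlinarith [mul_nonneg hμ.le (sub_nonneg.2 heq)]
    have hy : f y₀ ≤ f (A x) :=
      hy₀ (mem_closedBall_zero_iff.2 (hA.trans (le_max_left _ _)))
    have hL : ‖Lm x‖ ≤ R₂ := by
      by_contra! h
      have h₁ := hR₂ (Lm x) h.le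
      rw [hq, EReal.coe_le_coe_iff] at h₁
      have h₂ : q - e (Lm x) ≤ (j - f y₀) / μ := by
        rw [le_div_iff₀ hμ]
        linarith
      have h₃ : ‖B (Lm x)‖ ≤ C * R₁ := (hC x).trans (mul_le_mul_of_nonneg_left hA hC0)
      have h₄ : (‖B (Lm x)‖ + ‖B (Lm x₀)‖) ^ 2 ≤ (C * R₁ + ‖B (Lm x₀)‖) ^ 2 := by gcongr
      linarith [hele (Lm x)]
    exact max_le_max hA hL
end
end
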